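/- arXiv:1805.06968 — 5 statements merged into one kernel-verified Lean document; each statement's English description precedes it below -/
import Mathlib

section
/- Let 0 ≤ β < 1, n ≥ 1, a > 0, and define the operator R applied to a function f by R(f) = na · Σ_{k=0}^∞ (1/k!)(na + βk)^{k-1} e^{-(na+βk)} f(k/n). Then R(t ↦ t) = a/(1-β). -/
open Real

/-- The Szász-Mirakyan-Jain operator with parameter `a`. -/
noncomputable def SMJ (β : ℝ) (n : ℕ) (a : ℝ) (f : ℝ → ℝ) : ℝ :=
  n * a * ∑' k : ℕ,
    (n * a + β * k) ^ ((k : ℝ) - 1) / (Nat.factorial k : ℝ) *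
      Real.exp (-(n * a + β * k)) * f (k / n)

theorem Real.hasSum_pow_div_factorial (x : ℝ) :
    HasSum (fun i : ℕ => x ^ i / (i.factorial : ℝ)) (Real.exp x) := by
  rw [Real.exp_eq_exp_ℝ]
  exact NormedSpace.expSeries_div_hasSum_exp x

theorem sum_antidiagonal_shift_pow_mul_neg_pow (b c : ℝ) (m : ℕ) :
    ∑ p ∈ Finset.HasAntidiagonal.antidiagonal m, (b * (c + p.1)) ^ p.1 / (p.1.factorial : ℝ) *
      ((-(b * (c + p.1))) ^ p.2 / (p.2.factorial : ℝ)) = b ^ m := by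
  have h := congrFun (fwdDiff_iter_eq_factorial (R := ℝ) (n := m)) c
  rw [fwdDiff_iter_eq_sum_shift] at h
  rw [Finset.Nat.sum_antidiagonal_eq_sum_range_succ_mk]
  have hm : (m.factorial : ℝ) ≠ 0 := by positivity
  have h2 : b ^ m = b ^ m / m.factorial * m.factorial := by field_simp
  simp only [Pi.natCast_def] at h
  rw [h2]
  refine Eq.trans ?_ (congrArg (b ^ m / (m.factorial : ℝ) * ·) h)
  dsimp only
  rw [Finset.mul_sum]
  refine Finset.sum_congr rfl fun j hj => ?_
  have hj' : j ≤ m := Nat.lt_succ_iff.mp (Finset.mem_range.mp hj)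
  obtain ⟨i, rfl⟩ := Nat.exists_eq_add_of_le hj'
  rw [Nat.add_sub_cancel_left, neg_pow (b * (c + j)) i]
  simp only [zsmul_eq_mul, nsmul_eq_mul, mul_one]
  push_cast
  rw [Nat.cast_add_choose]
  field_simp
  rw [mul_pow, mul_pow]
  ring

/-- The coefficients of the power series `∑ (c + j) ^ j / j! * w ^ j`. -/
noncomputable def jainCoeff (c : ℝ) (j : ℕ) : ℝ := (c + j) ^ j / (j.factorial : ℝ)

theorem jainCoeff_nonneg {c : ℝ} (hc : 0 ≤ c) (j : ℕ) : 0 ≤ jainCoeff c j := by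
  unfold jainCoeff; positivity

theorem jainCoeff_mul_exp_neg_one_pow_le {c : ℝ} (hc : 0 ≤ c) (j : ℕ) :
    jainCoeff c j * Real.exp (-1) ^ j ≤ Real.exp c := by
  have h : jainCoeff c j ≤ Real.exp (c + j) :=
    Real.pow_div_factorial_le_exp _ (by positivity) j
  calc jainCoeff c j * Real.exp (-1) ^ j ≤ Real.exp (c + j) * Real.exp (-1) ^ j := by gcongr
    _ = Real.exp c := by rw [← Real.exp_nat_mul, ← Real.exp_add]; ring_nf

theorem summable_jainCoeff_mul_pow {c w : ℝ} (hc : 0 ≤ c) (hw : |w| < Real.exp (-1)) :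
    Summable fun j => jainCoeff c j * w ^ j := by
  have hr : |w| / Real.exp (-1) < 1 := by rwa [div_lt_one (Real.exp_pos _)]
  refine Summable.of_norm_bounded
    ((summable_geometric_of_lt_one (by positivity) hr).mul_left (Real.exp c)) fun j => ?_
  rw [norm_mul, norm_pow, Real.norm_eq_abs, Real.norm_eq_abs, abs_of_nonneg (jainCoeff_nonneg hc j)]
  calc jainCoeff c j * |w| ^ j
      = jainCoeff c j * Real.exp (-1) ^ j * (|w| / Real.exp (-1)) ^ j := by
        rw [div_pow]; field_simp
    _ ≤ _ := by
        gcongr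
        exact jainCoeff_mul_exp_neg_one_pow_le hc j

theorem analyticAt_tsum_jainCoeff {c w : ℝ} (hc : 0 ≤ c) (hw : |w| < Real.exp (-1)) :
    AnalyticAt ℝ (fun w => ∑' j, jainCoeff c j * w ^ j) w := by
  let p := FormalMultilinearSeries.ofScalars ℝ (jainCoeff c)
  let r : NNReal := ⟨Real.exp (-1), (Real.exp_pos _).le⟩
  have hrad : (r : ENNReal) ≤ p.radius := by
    refine p.le_radius_of_bound (Real.exp c) fun j => ?_
    rw [FormalMultilinearSeries.ofScalars_norm, Real.norm_eq_abs,
      abs_of_nonneg (jainCoeff_nonneg hc j)]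
    exact jainCoeff_mul_exp_neg_one_pow_le hc j
  have hpos : 0 < p.radius := lt_of_lt_of_le (by
    rw [ENNReal.coe_pos]; exact Real.exp_pos _) hrad
  have h := p.hasFPowerSeriesOnBall hpos
  have hsum : p.sum = fun w => ∑' j, jainCoeff c j * w ^ j :=
    FormalMultilinearSeries.ofScalarsSum_eq_tsum (E := ℝ) (jainCoeff c)
  rw [← hsum]
  refine h.analyticAt_of_mem (Metric.eball_subset_eball hrad ?_)
  rw [Metric.mem_eball, edist_zero_right, enorm_eq_nnnorm, ENNReal.coe_lt_coe]
  exact hw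

/-- For small `b` the identity follows by rearranging an absolutely convergent double series. -/
theorem tsum_jainCoeff_of_small {b c : ℝ} (hc : 0 ≤ c) (hb : |b| * Real.exp |b| < Real.exp (-1)) :
    ∑' j, jainCoeff c j * (b * Real.exp (-b)) ^ j = Real.exp (b * c) * (1 - b)⁻¹ := by
  let F : ℕ × ℕ → ℝ := fun p => (b * (c + p.1)) ^ p.1 / (p.1.factorial : ℝ) *
      ((-(b * (c + p.1))) ^ p.2 / (p.2.factorial : ℝ))
  have hrow : ∀ j, HasSum (fun i => F (j, i))
      ((b * (c + j)) ^ j / (j.factorial : ℝ) * Real.exp (-(b * (c + j)))) := fun j =>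
    (Real.hasSum_pow_div_factorial _).mul_left _
  have hnorm : ∀ j, HasSum (fun i => ‖F (j, i)‖)
      (Real.exp (|b| * c) * (jainCoeff c j * (|b| * Real.exp |b|) ^ j)) := fun j => by
    have hcj : 0 ≤ c + j := by positivity
    convert! (Real.hasSum_pow_div_factorial (|b| * (c + j))).mul_left
      ((|b| * (c + j)) ^ j / (j.factorial : ℝ)) using 1
    · ext i
      simp [F, abs_of_nonneg hcj]
    · rw [mul_add, Real.exp_add, ← mul_add, mul_pow, mul_pow, ← Real.exp_nat_mul,
        mul_comm |b| (j : ℝ)]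
      unfold jainCoeff
      ring
  have hF : Summable F := by
    refine Summable.of_norm ((summable_prod_of_nonneg fun _ => norm_nonneg _).mpr
      ⟨fun j => (hnorm j).summable, ?_⟩)
    simp_rw [(hnorm _).tsum_eq]
    refine (summable_jainCoeff_mul_pow hc ?_).mul_left _
    rwa [abs_of_nonneg (by positivity)]
  have hb1 : |b| < 1 := by
    have h1 : |b| ≤ |b| * Real.exp |b| :=
      le_mul_of_one_le_right (abs_nonneg b) (Real.one_le_exp (abs_nonneg b))
    have h2 : Real.exp (-1) < 1 := Real.exp_lt_one_iff.mpr (by norm_num)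
    linarith
  have hdiag : HasSum (fun m => b ^ m) (∑' p, F p) := by
    refine (Finset.HasAntidiagonal.sigmaAntidiagonalEquivProd.hasSum_iff.mpr hF.hasSum).sigma
      fun m => ?_
    rw [← sum_antidiagonal_shift_pow_mul_neg_pow b c m]
    exact Finset.hasSum (Finset.HasAntidiagonal.antidiagonal m) F
  have htot : ∑' p, F p = (1 - b)⁻¹ := hdiag.unique (hasSum_geometric_of_abs_lt_one hb1)
  have hrows := (hF.hasSum.prod_fiberwise hrow).mul_left (Real.exp (b * c))
  rw [htot] at hrows
  rw [← hrows.tsum_eq]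
  refine tsum_congr fun j => ?_
  have : Real.exp (-(b * (c + j))) = Real.exp (-(b * c)) * Real.exp (j * -b) := by
    rw [← Real.exp_add]; ring_nf
  rw [this, mul_pow, mul_pow, ← Real.exp_nat_mul, Real.exp_neg (b * c)]
  unfold jainCoeff
  field_simp

theorem abs_mul_exp_neg_lt {b : ℝ} (hb0 : 0 ≤ b) (hb1 : b < 1) :
    |b * Real.exp (-b)| < Real.exp (-1) := by
  rw [abs_of_nonneg (by positivity)]
  have h : b < Real.exp (b - 1) := by
    linarith [Real.add_one_lt_exp (x := b - 1) (by linarith)]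
  calc b * Real.exp (-b) < Real.exp (b - 1) * Real.exp (-b) := by gcongr
    _ = Real.exp (-1) := by rw [← Real.exp_add]; ring_nf

open Filter Topology in
theorem tsum_jainCoeff {b c : ℝ} (hc : 0 ≤ c) (hb0 : 0 ≤ b) (hb1 : b < 1) :
    ∑' j, jainCoeff c j * (b * Real.exp (-b)) ^ j = Real.exp (b * c) * (1 - b)⁻¹ := by
  have hl : AnalyticOnNhd ℝ (fun b => ∑' j, jainCoeff c j * (b * Real.exp (-b)) ^ j)
      (Set.Ico 0 1) := fun b hb =>
    (analyticAt_tsum_jainCoeff hc (abs_mul_exp_neg_lt hb.1 hb.2)).comp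
      (f := fun b => b * Real.exp (-b)) (by fun_prop)
  have hr : AnalyticOnNhd ℝ (fun b => Real.exp (b * c) * (1 - b)⁻¹) (Set.Ico 0 1) :=
    fun b hb => by
      have : 1 - b ≠ 0 := by linarith [hb.2]
      fun_prop (disch := assumption)
  refine hl.eqOn_of_preconnected_of_eventuallyEq hr isPreconnected_Ico
    (Set.left_mem_Ico.mpr one_pos) ?_ ⟨hb0, hb1⟩
  have hcont : Continuous fun b : ℝ => |b| * Real.exp |b| := by fun_prop
  have hev : ∀ᶠ b in 𝓝 (0 : ℝ), |b| * Real.exp |b| < Real.exp (-1) :=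
    hcont.continuousAt.eventually_lt_const (by simp [Real.exp_pos])
  filter_upwards [hev] with b hb using tsum_jainCoeff_of_small hc hb

/-- Jain's identity: the shifted generalized Poisson weights have total mass `1 / (1 - b)`. -/
theorem hasSum_jain {b y : ℝ} (hy : 0 ≤ y) (hb0 : 0 ≤ b) (hb1 : b < 1) :
    HasSum (fun j : ℕ => (y + b * j) ^ j / (j.factorial : ℝ) * Real.exp (-(y + b * j)))
      (1 - b)⁻¹ := by
  rcases hb0.eq_or_lt with rfl | hb
  · simpa [← Real.exp_add] using (Real.hasSum_pow_div_factorial y).mul_right (Real.exp (-y))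
  have hc : 0 ≤ y / b := by positivity
  have h := (summable_jainCoeff_mul_pow hc (abs_mul_exp_neg_lt hb0 hb1)).hasSum
  rw [tsum_jainCoeff hc hb0 hb1, mul_div_cancel₀ _ hb.ne'] at h
  convert! h.mul_left (Real.exp (-y)) using 1
  · ext j
    have h1 : Real.exp (-(y + b * j)) = Real.exp (-y) * Real.exp (j * -b) := by
      rw [← Real.exp_add]; ring_nf
    have h2 : y + b * j = b * (y / b + j) := by field_simp
    rw [h1, h2, mul_pow, mul_pow, ← Real.exp_nat_mul]
    unfold jainCoeff
    ring
  · rw [← mul_assoc, ← Real.exp_add]; simp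

/-- First moment of the SMJ operator: `R(t ↦ t) = a/(1-β)`. -/
theorem SMJ_moment_one (β a : ℝ) (n : ℕ) (hβ0 : 0 ≤ β) (hβ1 : β < 1)
    (hn : 1 ≤ n) (ha : 0 < a) :
    SMJ β n a (fun t => t) = a / (1 - β) := by
  have hn0 : (n : ℝ) ≠ 0 := by positivity
  have h := (hasSum_jain (y := n * a + β) (by positivity) hβ0 hβ1).mul_right ((n : ℝ)⁻¹)
  have hs : HasSum (fun k : ℕ => ((n : ℝ) * a + β * k) ^ ((k : ℝ) - 1) / (k.factorial : ℝ) *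
      Real.exp (-(n * a + β * k)) * ((k : ℝ) / n)) ((1 - β)⁻¹ * (n : ℝ)⁻¹) := by
    rw [← hasSum_nat_add_iff' 1]
    convert! h using 1
    · ext j
      have h1 : (n : ℝ) * a + β * ((j + 1 : ℕ) : ℝ) = n * a + β + β * j := by push_cast; ring
      have h2 : ((j + 1 : ℕ) : ℝ) - 1 = j := by push_cast; ring
      rw [h1, h2, Real.rpow_natCast, Nat.factorial_succ, Nat.cast_mul]
      have h3 : ((j + 1 : ℕ) : ℝ) ≠ 0 := by positivity
      field_simp
    · simp
  have h1 : 1 - β ≠ 0 := by linarith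
  rw [SMJ, hs.tsum_eq]
  field_simp
end

section
/- Let 0 ≤ β < 1, n ≥ 1, a > 0, and define R(f) = na · Σ_{k=0}^∞ (1/k!)(na + βk)^{k-1} e^{-(na+βk)} f(k/n). Then R(t ↦ t²) = a²/(1-β)² + a/(n(1-β)³). -/
open Real

/-- The sum `∑ (c + m) ^ m / m! * w ^ m`, convergent for `|w| < exp (-1)` when `0 ≤ c`. -/
noncomputable def abelSeries (c w : ℝ) : ℝ :=
  ∑' m : ℕ, (c + m) ^ m / (m.factorial : ℝ) * w ^ m

theorem abelCoeff_le {c : ℝ} (hc : 0 ≤ c) (m : ℕ) :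
    (c + m) ^ m / (m.factorial : ℝ) ≤ exp c * exp 1 ^ m := by
  have h := pow_div_factorial_le_exp (x := c + m) (by positivity) m
  rwa [exp_add, ← mul_one (m : ℝ), exp_nat_mul, mul_one] at h

theorem mul_exp_neg_lt_exp_neg_one {β : ℝ} (h1 : β < 1) : β * exp (-β) < exp (-1) := by
  have h := add_one_lt_exp (x := β - 1) (by linarith)
  have : exp (-1) = exp (β - 1) * exp (-β) := by rw [← exp_add]; ring_nf
  rw [this]
  gcongr
  linarith

theorem analyticAt_abelSeries {c : ℝ} (hc : 0 ≤ c) {w : ℝ} (hw : |w| < exp (-1)) :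
    AnalyticAt ℝ (abelSeries c) w := by
  set p := FormalMultilinearSeries.ofScalars ℝ
    (fun m : ℕ => (c + m) ^ m / (m.factorial : ℝ)) with hp
  obtain ⟨r, hr⟩ : ∃ r : NNReal, (r : ℝ) = exp (-1) := CanLift.prf _ (exp_pos _).le
  have hrad : (r : ENNReal) ≤ p.radius := by
    refine p.le_radius_of_bound (exp c) fun m => ?_
    rw [hp, FormalMultilinearSeries.ofScalars_norm, norm_of_nonneg (by positivity), hr]
    calc _ ≤ exp c * exp 1 ^ m * exp (-1) ^ m := by
          gcongr
          exact abelCoeff_le hc m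
      _ = exp c := by rw [mul_assoc, ← mul_pow, ← exp_add]; simp
  have hpos : 0 < p.radius := lt_of_lt_of_le (by
    rw [ENNReal.coe_pos, ← NNReal.coe_pos, hr]
    exact exp_pos (-1)) hrad
  have hsum : p.sum = abelSeries c := by
    funext x
    simp [hp, FormalMultilinearSeries.sum, abelSeries, mul_comm]
  rw [← hsum]
  refine (p.hasFPowerSeriesOnBall hpos).analyticAt_of_mem ?_
  refine Metric.eball_subset_eball hrad ?_
  rw [Metric.eball_coe]
  simpa [hr] using hw

theorem summable_deriv_bound {c : ℝ} (hc : 0 ≤ c) {r : ℝ} (hr0 : 0 < r) (hr : r < exp (-1)) :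
    Summable fun m : ℕ => (c + m) ^ m / (m.factorial : ℝ) * (m * r ^ (m - 1)) := by
  have hlt : ‖exp 1 * r‖ < 1 := by
    rw [norm_of_nonneg (by positivity)]
    calc exp 1 * r < exp 1 * exp (-1) := by gcongr
      _ = 1 := by rw [← exp_add]; simp
  refine Summable.of_nonneg_of_le (fun m => by positivity) (fun m => ?_)
    ((summable_pow_mul_geometric_of_norm_lt_one 1 hlt).mul_left (exp c / r))
  calc _ ≤ exp c * exp 1 ^ m * (m * r ^ (m - 1)) := by
        gcongr
        exact abelCoeff_le hc m
    _ = _ := by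
        rcases m with _ | m
        · simp
        · simp only [Nat.add_sub_cancel, mul_pow, pow_succ]
          field_simp

theorem summable_abelSeries {c : ℝ} (hc : 0 ≤ c) {w : ℝ} (hw0 : 0 < w) (hw : w < exp (-1)) :
    Summable fun m : ℕ => (c + m) ^ m / (m.factorial : ℝ) * w ^ m := by
  have hlt : exp 1 * w < 1 := by
    calc exp 1 * w < exp 1 * exp (-1) := by gcongr
      _ = 1 := by rw [← exp_add]; simp
  refine Summable.of_nonneg_of_le (fun m => by positivity) (fun m => ?_)
    ((summable_geometric_of_lt_one (by positivity) hlt).mul_left (exp c))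
  rw [mul_pow, ← mul_assoc]
  gcongr
  exact abelCoeff_le hc m

theorem hasDerivAt_abelSeries {c : ℝ} (hc : 0 ≤ c) {w : ℝ} (hw0 : 0 < w) (hw : w < exp (-1)) :
    HasDerivAt (abelSeries c)
      (∑' m : ℕ, (c + m) ^ m / (m.factorial : ℝ) * (m * w ^ (m - 1))) w := by
  obtain ⟨r, hwr, hr⟩ := exists_between hw
  refine hasDerivAt_tsum_of_isPreconnected (t := Set.Ioo 0 r) (y₀ := w)
    (summable_deriv_bound hc (hw0.trans hwr) hr) isOpen_Ioo isPreconnected_Ioo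
    (fun m y _ => (hasDerivAt_pow m y).const_mul _) (fun m y hy => ?_) ⟨hw0, hwr⟩
    (summable_abelSeries hc hw0 hw) ⟨hw0, hwr⟩
  have hy0 := hy.1
  rw [norm_of_nonneg (by positivity)]
  gcongr
  exact hy.2.le

open Finset in
/-- The `N`-th finite difference of `x ^ N`, as a sum over the antidiagonal. -/
theorem sum_antidiagonal_neg_one_pow_mul_pow (c : ℝ) (N : ℕ) :
    ∑ p ∈ antidiagonal N, (c + p.1) ^ N * (-1) ^ p.2 /
      ((p.1.factorial : ℝ) * (p.2.factorial : ℝ)) = 1 := by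
  have h := fwdDiff_iter_eq_sum_shift (1 : ℝ) (fun r : ℝ => r ^ N) N c
  rw [fwdDiff_iter_eq_factorial] at h
  rw [Nat.sum_antidiagonal_eq_sum_range_succ
    (fun i j => (c + i) ^ N * (-1) ^ j / ((i.factorial : ℝ) * (j.factorial : ℝ)))]
  have hN : (N.factorial : ℝ) ≠ 0 := by positivity
  apply mul_left_cancel₀ hN
  rw [mul_one, mul_sum]
  simp only [Pi.natCast_apply] at h
  refine Eq.trans ?_ h.symm
  refine sum_congr rfl fun k hk => ?_
  have hk' : k ≤ N := Nat.lt_succ_iff.mp (mem_range.mp hk)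
  simp only [zsmul_eq_mul, nsmul_eq_mul, mul_one]
  push_cast
  rw [Nat.cast_choose ℝ hk']
  field_simp

theorem hasSum_exp_series (x : ℝ) : HasSum (fun j : ℕ => x ^ j / (j.factorial : ℝ)) (exp x) := by
  rw [exp_eq_exp_ℝ]
  exact NormedSpace.expSeries_div_hasSum_exp x

theorem abelSeries_of_small {c : ℝ} (hc : 0 ≤ c) {β : ℝ} (h0 : 0 < β) (h1 : β < 1 / 10) :
    abelSeries c (β * exp (-β)) = exp (β * c) / (1 - β) := by
  set f : ℕ × ℕ → ℝ := fun p => (c + p.1) ^ (p.1 + p.2) * (-1) ^ p.2 /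
      ((p.1.factorial : ℝ) * (p.2.factorial : ℝ)) * β ^ (p.1 + p.2) with hf
  have hrow (m : ℕ) : HasSum (fun j => f (m, j))
      ((c + m) ^ m / (m.factorial : ℝ) * β ^ m * exp (-(β * (c + m)))) := by
    convert! (hasSum_exp_series (-(β * (c + m)))).mul_left
      ((c + m) ^ m / (m.factorial : ℝ) * β ^ m) using 2 with j
    rw [neg_eq_neg_one_mul (β * (c + m))]
    simp only [hf, mul_pow, pow_add]
    field_simp
  have hrow' (m : ℕ) : HasSum (fun j => ‖f (m, j)‖)
      ((c + m) ^ m / (m.factorial : ℝ) * β ^ m * exp (β * (c + m))) := by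
    convert! (hasSum_exp_series (β * (c + m))).mul_left
      ((c + m) ^ m / (m.factorial : ℝ) * β ^ m) using 2 with j
    have : (0 : ℝ) ≤ c + m := by positivity
    simp only [hf, mul_pow, pow_add, norm_mul, norm_div, norm_pow, norm_neg, norm_one, one_pow,
      norm_of_nonneg h0.le, norm_of_nonneg this, Real.norm_natCast]
    field_simp
  have hsmall : exp 1 * (β * exp β) < 1 := by
    have h3 := exp_one_lt_three
    have : exp β ≤ exp 1 := by gcongr; linarith
    have : exp 1 * (β * exp β) ≤ 3 * (1 / 10 * 3) := by gcongr; linarith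
    linarith
  have hsum : Summable f := by
    refine Summable.of_norm ((summable_prod_of_nonneg fun p => norm_nonneg _).2
      ⟨fun m => (hrow' m).summable, ?_⟩)
    simp_rw [(hrow' _).tsum_eq]
    refine Summable.of_nonneg_of_le (fun m => by positivity) (fun m => ?_)
      ((summable_geometric_of_lt_one (by positivity) hsmall).mul_left (exp c * exp (β * c)))
    calc _ ≤ exp c * exp 1 ^ m * β ^ m * exp (β * (c + m)) := by
          gcongr
          exact abelCoeff_le hc m
      _ = _ := by
          rw [mul_add, exp_add, mul_comm β (m : ℝ), exp_nat_mul]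
          ring
  have hrows : ∑' p, f p = exp (-(β * c)) * abelSeries c (β * exp (-β)) := by
    rw [hsum.tsum_prod, abelSeries, ← tsum_mul_left]
    refine tsum_congr fun m => ?_
    rw [(hrow m).tsum_eq, mul_pow, ← exp_nat_mul, mul_add, neg_add, exp_add]
    ring_nf
  have hdiag : ∑' p, f p = (1 - β)⁻¹ := by
    rw [← tsum_geometric_of_lt_one h0.le (by linarith),
      ← Finset.HasAntidiagonal.sigmaAntidiagonalEquivProd.tsum_eq f]
    refine (Finset.HasAntidiagonal.sigmaAntidiagonalEquivProd.summable_iff.2 hsum).tsum_sigma.trans ?_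
    refine tsum_congr fun N => ?_
    rw [tsum_fintype]
    calc _ = ∑ p ∈ Finset.HasAntidiagonal.antidiagonal N, f p := Finset.sum_coe_sort _ f
      _ = ∑ p ∈ Finset.HasAntidiagonal.antidiagonal N, (c + p.1) ^ N * (-1) ^ p.2 /
            ((p.1.factorial : ℝ) * (p.2.factorial : ℝ)) * β ^ N := by
          refine Finset.sum_congr rfl fun p hp => ?_
          simp only [hf, Finset.HasAntidiagonal.mem_antidiagonal.1 hp]
      _ = β ^ N := by
          rw [← Finset.sum_mul, sum_antidiagonal_neg_one_pow_mul_pow, one_mul]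
  have h := hrows.symm.trans hdiag
  rw [exp_neg] at h
  have := exp_pos (β * c)
  rw [div_eq_mul_inv, ← h]
  field_simp

/-- Abel's identity `∑ (c + m) ^ m / m! * (β * exp (-β)) ^ m = exp (β * c) / (1 - β)`. -/
theorem abelSeries_eq {c : ℝ} (hc : 0 ≤ c) :
    Set.EqOn (fun β => abelSeries c (β * exp (-β))) (fun β => exp (β * c) / (1 - β))
      (Set.Ioo 0 1) := by
  refine AnalyticOnNhd.eqOn_of_preconnected_of_eventuallyEq (𝕜 := ℝ) (z₀ := 1 / 20)
    (fun β hβ => ?_) (fun β hβ => ?_) isPreconnected_Ioo (by norm_num) ?_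
  · refine AnalyticAt.fun_comp (analyticAt_abelSeries hc ?_) (by fun_prop)
    have := hβ.1
    rw [abs_of_nonneg (by positivity)]
    exact mul_exp_neg_lt_exp_neg_one hβ.2
  · have : 1 - β ≠ 0 := by linarith [hβ.2]
    fun_prop (disch := assumption)
  · filter_upwards [Ioo_mem_nhds (show (0 : ℝ) < 1 / 20 by norm_num)
      (show (1 / 20 : ℝ) < 1 / 10 by norm_num)] with β hβ
    exact abelSeries_of_small hc hβ.1 hβ.2

theorem hasSum_succ_mul_abel_of_pos {β φ : ℝ} (h0 : 0 < β) (h1 : β < 1) (hφ : 0 ≤ φ) :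
    HasSum (fun m : ℕ => ((m : ℝ) + 1) * ((φ + β * m) ^ m / (m.factorial : ℝ) *
      exp (-(φ + β * m)))) (1 / (1 - β) + φ / (1 - β) ^ 2 + β / (1 - β) ^ 3) := by
  obtain ⟨c, rfl⟩ : ∃ c, φ = β * c := ⟨φ / β, by field_simp⟩
  have hc : 0 ≤ c := by nlinarith
  have h1' : 1 - β ≠ 0 := by linarith
  set w := β * exp (-β) with hw
  have hw0 : 0 < w := by positivity
  have hw1 : w < exp (-1) := mul_exp_neg_lt_exp_neg_one h1
  set D := ∑' m : ℕ, (c + m) ^ m / (m.factorial : ℝ) * (m * w ^ (m - 1)) with hD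
  have hderiv : D * (exp (-β) * (1 - β)) =
      (exp (β * c) * c * (1 - β) + exp (β * c)) / (1 - β) ^ 2 := by
    have hinner : HasDerivAt (fun x : ℝ => x * exp (-x)) (exp (-β) * (1 - β)) β := by
      convert! (hasDerivAt_id β).mul (hasDerivAt_neg β).exp using 1
      simp
      ring
    have hL := (hasDerivAt_abelSeries hc hw0 hw1).comp β hinner
    have hR : HasDerivAt (fun x : ℝ => exp (x * c) / (1 - x))
        ((exp (β * c) * c * (1 - β) + exp (β * c)) / (1 - β) ^ 2) β := by
      convert! ((hasDerivAt_id β).mul_const c).exp.div ((hasDerivAt_id β).const_sub 1) h1' using 1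
      simp
    refine hL.unique (hR.congr_of_eventuallyEq ?_)
    filter_upwards [Ioo_mem_nhds h0 h1] with x hx
    exact abelSeries_eq hc hx
  have hP : abelSeries c w = exp (β * c) / (1 - β) := abelSeries_eq hc ⟨h0, h1⟩
  have hS : HasSum (fun m : ℕ => exp (-(β * c)) *
      ((c + m) ^ m / (m.factorial : ℝ) * w ^ m +
        w * ((c + m) ^ m / (m.factorial : ℝ) * (m * w ^ (m - 1)))))
      (exp (-(β * c)) * (abelSeries c w + w * D)) :=
    ((summable_abelSeries hc hw0 hw1).hasSum.add
      ((summable_deriv_bound hc hw0 hw1).hasSum.mul_left w)).mul_left _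
  convert! hS using 1
  · funext m
    have hpow : w * (m * w ^ (m - 1)) = m * w ^ m := by
      rcases m with _ | m
      · simp
      · rw [Nat.add_sub_cancel, pow_succ]; ring
    have hexp : exp (-(β * c + β * m)) = exp (-(β * c)) * exp (-β) ^ m := by
      rw [← exp_nat_mul, ← exp_add]; ring_nf
    rw [mul_left_comm w, hpow, hexp, ← mul_add β, mul_pow, hw, mul_pow]
    ring
  · have hE := exp_pos (-β)
    have hD' : w * D = β * ((exp (β * c) * c * (1 - β) + exp (β * c)) / (1 - β) ^ 3) := by
      have : D * exp (-β) = (exp (β * c) * c * (1 - β) + exp (β * c)) / (1 - β) ^ 3 := by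
        field_simp at hderiv ⊢
        linear_combination hderiv
      rw [← this, hw]; ring
    rw [hP, hD', exp_neg]
    have := exp_pos (β * c)
    field_simp
    ring

theorem hasSum_succ_mul_poisson (φ : ℝ) :
    HasSum (fun m : ℕ => ((m : ℝ) + 1) * (φ ^ m / (m.factorial : ℝ) * exp (-φ))) (1 + φ) := by
  have h := hasSum_exp_series φ
  have h' : HasSum (fun m : ℕ => m * (φ ^ m / (m.factorial : ℝ))) (φ * exp φ) := by
    rw [← hasSum_nat_add_iff' 1]
    simp only [Finset.sum_range_one, Nat.cast_zero, zero_mul, sub_zero]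
    convert! h.mul_left φ using 2 with m
    rw [Nat.factorial_succ, pow_succ]
    push_cast
    field_simp
  convert! (h'.add h).mul_right (exp (-φ)) using 1
  · funext m; ring
  · have := exp_pos φ
    rw [exp_neg]
    field_simp
    ring

theorem hasSum_succ_mul_abel {β φ : ℝ} (h0 : 0 ≤ β) (h1 : β < 1) (hφ : 0 ≤ φ) :
    HasSum (fun m : ℕ => ((m : ℝ) + 1) * ((φ + β * m) ^ m / (m.factorial : ℝ) *
      exp (-(φ + β * m)))) (1 / (1 - β) + φ / (1 - β) ^ 2 + β / (1 - β) ^ 3) := by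
  rcases h0.eq_or_lt with rfl | h0
  · simpa using hasSum_succ_mul_poisson φ
  · exact hasSum_succ_mul_abel_of_pos h0 h1 hφ

/-- Second moment of the SMJ operator. -/
theorem SMJ_moment_two (β a : ℝ) (n : ℕ) (hβ0 : 0 ≤ β) (hβ1 : β < 1)
    (hn : 1 ≤ n) (ha : 0 < a) :
    SMJ β n a (fun t => t ^ 2) = a ^ 2 / (1 - β) ^ 2 + a / (n * (1 - β) ^ 3) := by
  have hn0 : (0 : ℝ) < n := by exact_mod_cast hn
  have h1 : 1 - β ≠ 0 := by linarith
  have h := (hasSum_succ_mul_abel hβ0 hβ1 (φ := n * a + β) (by positivity)).div_const ((n : ℝ) ^ 2)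
  have hS : HasSum (fun k : ℕ => (n * a + β * k) ^ ((k : ℝ) - 1) / (Nat.factorial k : ℝ) *
      Real.exp (-(n * a + β * k)) * ((k : ℝ) / n) ^ 2)
      ((1 / (1 - β) + (n * a + β) / (1 - β) ^ 2 + β / (1 - β) ^ 3) / (n : ℝ) ^ 2) := by
    rw [← hasSum_nat_add_iff' 1]
    simp only [Finset.sum_range_one, Nat.cast_zero, zero_div, ne_eq, OfNat.ofNat_ne_zero,
      not_false_eq_true, zero_pow, mul_zero, sub_zero]
    convert! h using 2 with m
    have hbase : n * a + β * ((m + 1 : ℕ) : ℝ) = n * a + β + β * m := by push_cast; ring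
    rw [hbase, Nat.cast_succ, add_sub_cancel_right, rpow_natCast, Nat.factorial_succ]
    push_cast
    field_simp
  rw [SMJ, hS.tsum_eq]
  field_simp
  ring
end

section
/- Let 0 ≤ β < 1, n ≥ 1, a > 0, and define R(f) = na · Σ_{k=0}^∞ (1/k!)(na + βk)^{k-1} e^{-(na+βk)} f(k/n). Then R(t ↦ t³) = a³/(1-β)³ + 3a²/(n(1-β)⁴) + (1+2β)a/(n²(1-β)⁵). -/
open Real

open Filter Topology Finset

/-- The coefficients `m (m + β k)^(k - 1) / k!` of the Abel series. -/
noncomputable def abelCoeff (β m : ℝ) (k : ℕ) : ℝ :=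
  m * (m + β * k) ^ k / (m + β * k) / (Nat.factorial k : ℝ)

/-- The power series `∑ k, k ^ p * c k * z ^ k`. -/
noncomputable def eulerSeries (c : ℕ → ℝ) (p : ℕ) (z : ℝ) : ℝ :=
  ∑' k : ℕ, (k : ℝ) ^ p * c k * z ^ k

theorem summable_pow_mul_coeff {c : ℕ → ℝ} {R C : ℝ} (hR : 0 < R)
    (hc : ∀ k, |c k| * R ^ k ≤ C) (p : ℕ) {z : ℝ} (hz : |z| < R) :
    Summable fun k : ℕ => (k : ℝ) ^ p * c k * z ^ k := by
  have h1 : ‖|z| / R‖ < 1 := by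
    rw [Real.norm_of_nonneg (by positivity)]
    exact (div_lt_one hR).2 hz
  refine Summable.of_norm_bounded ((summable_pow_mul_geometric_of_norm_lt_one p h1).mul_left C)
    fun k => ?_
  have h2 : ‖(k : ℝ) ^ p * c k * z ^ k‖ = (|c k| * R ^ k) * ((k : ℝ) ^ p * (|z| / R) ^ k) := by
    simp only [norm_mul, norm_pow, Real.norm_eq_abs, Nat.abs_cast, div_pow]
    field_simp
  rw [h2]
  exact mul_le_mul_of_nonneg_right (hc k) (by positivity)

theorem exists_hasDerivAt_eulerSeries {c : ℕ → ℝ} {R C : ℝ} (hR : 0 < R)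
    (hc : ∀ k, |c k| * R ^ k ≤ C) (p : ℕ) {z : ℝ} (hz : |z| < R) :
    ∃ d, HasDerivAt (eulerSeries c p) d z ∧ z * d = eulerSeries c (p + 1) z := by
  obtain ⟨r, hzr, hrR⟩ := exists_between hz
  have hr : 0 < r := (abs_nonneg z).trans_lt hzr
  have hu : Summable fun k : ℕ => |(k : ℝ) ^ (p + 1) * c k * r ^ k| / r :=
    ((summable_pow_mul_coeff hR hc (p + 1) (by rwa [abs_of_pos hr])).abs).div_const r
  refine ⟨∑' k : ℕ, (k : ℝ) ^ p * c k * (k * z ^ (k - 1)), ?_, ?_⟩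
  · refine hasDerivAt_tsum_of_isPreconnected (t := Metric.ball (0 : ℝ) r) (y₀ := z)
      (g := fun (k : ℕ) z => (k : ℝ) ^ p * c k * z ^ k)
      (g' := fun (k : ℕ) z => (k : ℝ) ^ p * c k * (k * z ^ (k - 1)))
      hu Metric.isOpen_ball (convex_ball _ _).isPreconnected
      (fun k y _ => (hasDerivAt_pow k y).const_mul _) ?_ ?_
      (summable_pow_mul_coeff hR hc p hz) ?_
    · intro k y hy
      have hy' : |y| ≤ r := by simpa using (mem_ball_zero_iff.1 hy).le
      rcases k with _ | k
      · simp
      · simp only [norm_mul, norm_pow, Real.norm_eq_abs, Nat.abs_cast, abs_mul, abs_pow,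
          abs_of_pos hr, Nat.add_sub_cancel]
        have h3 := pow_le_pow_left₀ (abs_nonneg y) hy' k
        calc _ = ((k + 1 : ℕ) : ℝ) ^ (p + 1) * |c (k + 1)| * |y| ^ k := by ring
          _ ≤ ((k + 1 : ℕ) : ℝ) ^ (p + 1) * |c (k + 1)| * r ^ k := by gcongr
          _ = _ := by field_simp; ring
    · simpa using hzr
    · simpa using hzr
  · rw [eulerSeries, ← tsum_mul_left]
    refine tsum_congr fun k => ?_
    rcases k with _ | k
    · simp
    · simp only [Nat.add_sub_cancel]
      ring

theorem analyticAt_eulerSeries_zero {c : ℕ → ℝ} {R C : ℝ} (hR : 0 < R)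
    (hc : ∀ k, |c k| * R ^ k ≤ C) {z : ℝ} (hz : |z| < R) :
    AnalyticAt ℝ (eulerSeries c 0) z := by
  obtain ⟨r, hzr, hrR⟩ := exists_between hz
  have hr : 0 < r := (abs_nonneg z).trans_lt hzr
  have hrad : ENNReal.ofReal r ≤ (FormalMultilinearSeries.ofScalars ℝ c).radius := by
    refine FormalMultilinearSeries.le_radius_of_summable_norm _ ?_
    have := (summable_pow_mul_coeff hR hc 0 (z := r) (by rwa [abs_of_pos hr])).norm
    simpa [FormalMultilinearSeries.ofScalars_norm, hr.le, abs_of_pos hr] using this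
  have hpos : 0 < (FormalMultilinearSeries.ofScalars ℝ c).radius :=
    (ENNReal.ofReal_pos.2 hr).trans_le hrad
  have h := (FormalMultilinearSeries.ofScalars ℝ c).hasFPowerSeriesOnBall hpos
  have hfun : (FormalMultilinearSeries.ofScalars ℝ c).sum = eulerSeries c 0 := by
    funext x
    have := FormalMultilinearSeries.ofScalars_sum_eq c x
    simpa [eulerSeries, FormalMultilinearSeries.ofScalarsSum] using this
  rw [hfun] at h
  refine h.analyticAt_of_mem (Metric.eball_subset_eball hrad ?_)
  rw [Metric.eball_ofReal]
  simpa using hzr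

/-- The radius `R` lies strictly beyond `exp (-β)`. -/
theorem exists_abelCoeff_bound {β m : ℝ} (hβ0 : 0 ≤ β) (hβ1 : β < 1) (hm : 0 < m) :
    ∃ R C : ℝ, exp (-β) < R ∧ ∀ k, |abelCoeff β m k| * R ^ k ≤ C := by
  set s : ℝ := 2 - β with hs
  have hs0 : 0 < s := by linarith
  refine ⟨s * exp (-(s * β)), exp (s * m), ?_, fun k => ?_⟩
  · have h1 := Real.add_one_le_exp (-((1 - β) * β))
    have h2 : 1 < s * exp (-((1 - β) * β)) := by
      nlinarith [mul_pos (sub_pos.2 hβ1) (sub_pos.2 hβ1)]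
    calc exp (-β) = 1 * exp (-β) := (one_mul _).symm
      _ < s * exp (-((1 - β) * β)) * exp (-β) := by gcongr
      _ = _ := by rw [mul_assoc, ← Real.exp_add, hs]; ring_nf
  · have hk : 0 < m + β * k := by positivity
    have hle : m / (m + β * k) ≤ 1 := (div_le_one hk).2 (by nlinarith [mul_nonneg hβ0 k.cast_nonneg])
    have h1 := Real.pow_div_factorial_le_exp (s * (m + β * k)) (by positivity) k
    have h2 : |abelCoeff β m k| = m / (m + β * k) * ((m + β * k) ^ k / (Nat.factorial k : ℝ)) := by
      rw [abs_of_nonneg (by unfold abelCoeff; positivity), abelCoeff]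
      ring
    calc |abelCoeff β m k| * (s * exp (-(s * β))) ^ k
        = m / (m + β * k) * ((s * (m + β * k)) ^ k / (Nat.factorial k : ℝ)) *
            exp (-(s * β) * k) := by
          rw [h2, mul_pow, mul_pow, ← Real.exp_nat_mul, mul_comm (k : ℝ)]; ring
      _ ≤ 1 * exp (s * (m + β * k)) * exp (-(s * β) * k) := by gcongr
      _ = exp (s * m) := by rw [one_mul, ← Real.exp_add]; ring_nf

theorem sum_antidiagonal_abel {β m : ℝ} (hβ0 : 0 ≤ β) (hm : 0 < m) (N : ℕ) :
    ∑ x ∈ antidiagonal N, abelCoeff β m x.1 *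
      ((-(m + β * x.1)) ^ x.2 / (Nat.factorial x.2 : ℝ)) = if N = 0 then 1 else 0 := by
  rcases N with _ | N
  · simp [abelCoeff, hm.ne']
  · set P : Polynomial ℝ := (Polynomial.C β * Polynomial.X + Polynomial.C m) ^ N with hP
    have hdeg : P.natDegree < N + 1 := by
      have h1 := Polynomial.natDegree_pow_le_of_le N
        (Polynomial.natDegree_linear_le (a := β) (b := m))
      rw [mul_one] at h1
      exact Nat.lt_succ_of_le h1
    have h0 := congrFun (Polynomial.fwdDiff_iter_eq_zero_of_degree_lt hdeg) 0
    rw [fwdDiff_iter_eq_sum_shift, Pi.zero_apply] at h0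
    rw [Nat.sum_antidiagonal_eq_sum_range_succ_mk, if_neg N.succ_ne_zero]
    refine Eq.trans ?_ (mul_eq_zero_of_right (m / ((N + 1).factorial : ℝ)) h0)
    rw [mul_sum]
    refine sum_congr rfl fun k hk => ?_
    have hkN : k ≤ N + 1 := Nat.lt_succ_iff.1 (mem_range.1 hk)
    have hpos : 0 < m + β * k := by positivity
    have h2 : (m + β * k) ^ k * (m + β * k) ^ (N + 1 - k) = (m + β * k) ^ N * (m + β * k) := by
      rw [← pow_add, Nat.add_sub_cancel' hkN, pow_succ]
    have h3 : P.eval ((0 : ℝ) + k • (1 : ℝ)) = (m + β * k) ^ N := by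
      simp [hP, add_comm]
    rw [h3, abelCoeff, neg_pow, zsmul_eq_mul]
    push_cast
    rw [Nat.cast_choose ℝ hkN]
    field_simp
    linear_combination h2

theorem eulerSeries_abel_of_small {β m R C w : ℝ} (hβ0 : 0 ≤ β) (hm : 0 < m) (hR : 0 < R)
    (hc : ∀ k, |abelCoeff β m k| * R ^ k ≤ C) (hw : |w| * exp (β * |w|) < R) :
    eulerSeries (abelCoeff β m) 0 (w * exp (-(β * w))) = exp (m * w) := by
  have hpos : ∀ k : ℕ, 0 < m + β * k := fun k => by positivity
  have hexp : ∀ x : ℝ, HasSum (fun j : ℕ => x ^ j / (Nat.factorial j : ℝ)) (exp x) := fun x => by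
    rw [Real.exp_eq_exp_ℝ]
    exact NormedSpace.expSeries_div_hasSum_exp x
  set F : ℕ × ℕ → ℝ := fun x => abelCoeff β m x.1 * w ^ x.1 *
    ((-(m + β * x.1) * w) ^ x.2 / (Nat.factorial x.2 : ℝ)) with hF
  have hFs : Summable F := by
    rw [← summable_norm_iff, summable_prod_of_nonneg fun x => norm_nonneg _]
    have hn : ∀ k : ℕ, HasSum (fun j => ‖F (k, j)‖)
        (|abelCoeff β m k * w ^ k| * exp ((m + β * k) * |w|)) := fun k => by
      have hj : ∀ j, ‖F (k, j)‖ = |abelCoeff β m k * w ^ k| *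
          (((m + β * k) * |w|) ^ j / (Nat.factorial j : ℝ)) := fun j => by
        simp only [hF, norm_mul, norm_div, norm_pow, Real.norm_eq_abs, Nat.abs_cast, abs_neg,
          abs_of_pos (hpos k), abs_mul, abs_pow]
      simpa only [hj] using (hexp ((m + β * k) * |w|)).mul_left (|abelCoeff β m k * w ^ k|)
    refine ⟨fun k => (hn k).summable, ?_⟩
    have h1 := ((summable_pow_mul_coeff hR hc 0 (z := |w| * exp (β * |w|))
      (by rwa [abs_of_nonneg (by positivity)])).norm).mul_left (exp (m * |w|))
    refine h1.congr fun k => ?_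
    rw [(hn k).tsum_eq, add_mul, Real.exp_add, mul_pow, ← Real.exp_nat_mul]
    simp only [norm_mul, norm_pow, Real.norm_eq_abs, abs_mul, abs_pow, abs_abs, Real.abs_exp,
      pow_zero, one_mul]
    ring_nf
  have h1 : ∑' x, F x = eulerSeries (abelCoeff β m) 0 (w * exp (-(β * w))) * exp (-(m * w)) := by
    rw [hFs.tsum_prod, eulerSeries, ← tsum_mul_right]
    refine tsum_congr fun k => ?_
    rw [((hexp (-(m + β * k) * w)).mul_left (abelCoeff β m k * w ^ k)).tsum_eq, mul_pow,
      ← Real.exp_nat_mul, pow_zero, one_mul, ← mul_assoc, mul_assoc _ (exp _) (exp _),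
      ← Real.exp_add]
    ring_nf
  have h2 : ∑' x, F x = 1 := by
    have hN : ∀ N : ℕ, ∑' x : antidiagonal N, F x = if N = 0 then 1 else 0 := fun N => by
      rw [tsum_fintype, sum_coe_sort (antidiagonal N) F]
      have h3 := congrArg (w ^ N * ·) (sum_antidiagonal_abel hβ0 hm N)
      simp only [mul_sum] at h3
      refine Eq.trans (sum_congr rfl fun x hx => ?_) (h3.trans ?_)
      · rw [← mem_antidiagonal.1 hx]
        simp only [hF, mul_pow, pow_add]
        ring
      · split_ifs with h <;> simp [h]
    have hs := HasAntidiagonal.sigmaAntidiagonalEquivProd.summable_iff.2 hFs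
    have h3 := HasAntidiagonal.sigmaAntidiagonalEquivProd.tsum_eq F
    rw [← h3]
    refine (hs.tsum_sigma' fun n => (hasSum_fintype _).summable).trans ?_
    exact (tsum_congr hN).trans (tsum_ite_eq 0 _)
  rw [h2, Real.exp_neg (m * w), eq_mul_inv_iff_mul_eq₀ (Real.exp_ne_zero _), one_mul] at h1
  exact h1.symm

theorem eulerSeries_abel_eventually {β m R C : ℝ} (hβ0 : 0 ≤ β) (hβ1 : β < 1) (hm : 0 < m)
    (hR : exp (-β) < R) (hc : ∀ k, |abelCoeff β m k| * R ^ k ≤ C) :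
    ∀ᶠ w in 𝓝 (1 : ℝ),
      eulerSeries (abelCoeff β m) 0 (w * exp (-(β * w))) = exp (m * w) := by
  have hR0 : 0 < R := (Real.exp_pos _).trans hR
  have hφ : ∀ w ∈ Set.Icc (0 : ℝ) 1, |w * exp (-(β * w))| < R := fun w hw => by
    rw [abs_of_nonneg (mul_nonneg hw.1 (Real.exp_pos _).le)]
    refine lt_of_le_of_lt ?_ hR
    have h1 := Real.add_one_le_exp (β * (w - 1))
    calc w * exp (-(β * w)) ≤ exp (β * (w - 1)) * exp (-(β * w)) := by
          gcongr
          nlinarith [mul_nonneg (sub_nonneg.2 hβ1.le) (sub_nonneg.2 hw.2)]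
      _ = exp (-β) := by rw [← Real.exp_add]; ring_nf
  have hf : AnalyticOnNhd ℝ
      (fun w => eulerSeries (abelCoeff β m) 0 (w * exp (-(β * w)))) (Set.Icc 0 1) := fun w hw =>
    (analyticAt_eulerSeries_zero hR0 hc (hφ w hw)).fun_comp (f := fun w : ℝ => w * exp (-(β * w)))
      (by fun_prop)
  have hg : AnalyticOnNhd ℝ (fun w : ℝ => exp (m * w)) (Set.Icc 0 1) := fun w _ => by fun_prop
  have h0 : ∀ᶠ w in 𝓝 (0 : ℝ), |w| * exp (β * |w|) < R := by
    have : Continuous fun w : ℝ => |w| * exp (β * |w|) := by fun_prop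
    exact this.continuousAt.eventually_lt_const (by simpa using hR0)
  have heq := hf.eqOn_of_preconnected_of_eventuallyEq hg isPreconnected_Icc
    (Set.left_mem_Icc.2 zero_le_one)
    (h0.mono fun w hw => eulerSeries_abel_of_small hβ0 hm hR0 hc hw)
  have h1 : (1 : ℝ) ∈ Set.Icc (0 : ℝ) 1 := Set.right_mem_Icc.2 zero_le_one
  refine ((hf 1 h1).frequently_eq_iff_eventually_eq (hg 1 h1)).1 ?_
  have hlt : ∀ᶠ w in 𝓝[<] (1 : ℝ), eulerSeries (abelCoeff β m) 0 (w * exp (-(β * w))) =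
      exp (m * w) := by
    filter_upwards [Ioo_mem_nhdsLT zero_lt_one] with w hw
    exact heq (Set.Ioo_subset_Icc_self hw)
  exact hlt.frequently.filter_mono (nhdsWithin_mono _ fun w hw => ne_of_lt hw)

theorem eulerSeries_comp_succ_eventually {β R C : ℝ} {c : ℕ → ℝ} {f f' : ℝ → ℝ} {p : ℕ}
    (hR : exp (-β) < R) (hc : ∀ k, |c k| * R ^ k ≤ C)
    (hf : ∀ᶠ w in 𝓝 (1 : ℝ), eulerSeries c p (w * exp (-(β * w))) = f w)
    (hf' : ∀ᶠ w in 𝓝 (1 : ℝ), HasDerivAt f (f' w) w) :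
    ∀ᶠ w in 𝓝 (1 : ℝ), (1 - β * w) * eulerSeries c (p + 1) (w * exp (-(β * w))) = w * f' w := by
  have hR0 : 0 < R := (Real.exp_pos _).trans hR
  have hφ : ∀ᶠ w in 𝓝 (1 : ℝ), |w * exp (-(β * w))| < R := by
    have : Continuous fun w : ℝ => |w * exp (-(β * w))| := by fun_prop
    exact this.continuousAt.eventually_lt_const (by simpa using hR)
  filter_upwards [hf.eventually_nhds, hf', hφ] with w h1 h2 h3
  obtain ⟨d, hd, hzd⟩ := exists_hasDerivAt_eulerSeries hR0 hc p h3
  have hφ' : HasDerivAt (fun w : ℝ => w * exp (-(β * w))) ((1 - β * w) * exp (-(β * w))) w := by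
    refine ((hasDerivAt_id' w).mul (((hasDerivAt_id' w).const_mul β).neg.exp)).congr_deriv ?_
    simp only [Pi.neg_apply]
    ring
  have h4 := (hd.comp w hφ').unique (h2.congr_of_eventuallyEq (f₁ := eulerSeries c p ∘ _) h1)
  rw [← hzd, ← h4]
  ring

theorem eulerSeries_abel_three {β m : ℝ} (hβ0 : 0 ≤ β) (hβ1 : β < 1) (hm : 0 < m) :
    eulerSeries (abelCoeff β m) 3 (exp (-β)) =
      (m ^ 3 / (1 - β) ^ 3 + 3 * m ^ 2 / (1 - β) ^ 4 + (1 + 2 * β) * m / (1 - β) ^ 5) *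
        exp m := by
  obtain ⟨R, C, hR, hc⟩ := exists_abelCoeff_bound hβ0 hβ1 hm
  have hne : ∀ᶠ w in 𝓝 (1 : ℝ), 0 < 1 - β * w := by
    have : Continuous fun w : ℝ => 1 - β * w := by fun_prop
    exact this.continuousAt.eventually_const_lt (by simpa using hβ1)
  have hE : ∀ w : ℝ, HasDerivAt (fun w => exp (m * w)) (m * exp (m * w)) w := fun w => by
    simpa [mul_comm] using ((hasDerivAt_id' w).const_mul m).exp
  have hv : ∀ w : ℝ, HasDerivAt (fun w => 1 - β * w) (-β) w := fun w => by
    simpa using ((hasDerivAt_id' w).const_mul β).const_sub 1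
  have h0 := eulerSeries_abel_eventually hβ0 hβ1 hm hR hc
  have h1 : ∀ᶠ w in 𝓝 (1 : ℝ), eulerSeries (abelCoeff β m) 1 (w * exp (-(β * w))) =
      m * w / (1 - β * w) * exp (m * w) := by
    filter_upwards [eulerSeries_comp_succ_eventually hR hc h0 (Eventually.of_forall hE), hne]
      with w h hw
    rw [zero_add] at h
    refine mul_left_cancel₀ hw.ne' (h.trans ?_)
    rw [← mul_assoc, ← mul_assoc, mul_div_cancel₀ _ hw.ne']
    ring
  have h2 : ∀ᶠ w in 𝓝 (1 : ℝ), eulerSeries (abelCoeff β m) 2 (w * exp (-(β * w))) =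
      (m * w / (1 - β * w) ^ 3 + m ^ 2 * w ^ 2 / (1 - β * w) ^ 2) * exp (m * w) := by
    have hd : ∀ᶠ w in 𝓝 (1 : ℝ), HasDerivAt (fun w => m * w / (1 - β * w) * exp (m * w))
        ((m / (1 - β * w) ^ 2 + m ^ 2 * w / (1 - β * w)) * exp (m * w)) w := by
      filter_upwards [hne] with w hw
      have hw0 := hw.ne'
      refine ((((hasDerivAt_id' w).const_mul m).div (hv w) hw0).mul (hE w)).congr_deriv ?_
      simp only [Pi.div_apply]
      field_simp
      ring
    filter_upwards [eulerSeries_comp_succ_eventually hR hc h1 hd, hne] with w h hw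
    have hw0 := hw.ne'
    refine mul_left_cancel₀ hw0 (h.trans ?_)
    field_simp
  have hd : ∀ᶠ w in 𝓝 (1 : ℝ), HasDerivAt
      (fun w => (m * w / (1 - β * w) ^ 3 + m ^ 2 * w ^ 2 / (1 - β * w) ^ 2) * exp (m * w))
      ((m * (1 + 2 * β * w) / (1 - β * w) ^ 4 + 3 * m ^ 2 * w / (1 - β * w) ^ 3 +
        m ^ 3 * w ^ 2 / (1 - β * w) ^ 2) * exp (m * w)) w := by
    filter_upwards [hne] with w hw
    have hw0 := hw.ne'
    refine (((((hasDerivAt_id' w).const_mul m).div ((hv w).pow 3) (pow_pos hw 3).ne').add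
      (((hasDerivAt_pow 2 w).const_mul (m ^ 2)).div ((hv w).pow 2) (pow_pos hw 2).ne')).mul
      (hE w)).congr_deriv ?_
    simp only [Pi.add_apply, Pi.div_apply, Pi.pow_apply]
    field_simp
    push_cast
    ring
  have h3 := (eulerSeries_comp_succ_eventually hR hc h2 hd).self_of_nhds
  have hb : 0 < 1 - β := by linarith
  simp only [mul_one, one_mul, one_pow] at h3
  refine mul_left_cancel₀ hb.ne' (h3.trans ?_)
  field_simp
  ring

/-- Third moment of the SMJ operator. -/
theorem SMJ_moment_three (β a : ℝ) (n : ℕ) (hβ0 : 0 ≤ β) (hβ1 : β < 1)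
    (hn : 1 ≤ n) (ha : 0 < a) :
    SMJ β n a (fun t => t ^ 3) =
      a ^ 3 / (1 - β) ^ 3 + 3 * a ^ 2 / (n * (1 - β) ^ 4) +
        (1 + 2 * β) * a / (n ^ 2 * (1 - β) ^ 5) := by
  have hn0 : (0 : ℝ) < n := by exact_mod_cast hn
  have hm : 0 < n * a := mul_pos hn0 ha
  have hb : 0 < 1 - β := by linarith
  have hS : SMJ β n a (fun t => t ^ 3) = exp (-(n * a)) / n ^ 3 *
      eulerSeries (abelCoeff β (n * a)) 3 (exp (-β)) := by
    rw [SMJ, eulerSeries, ← tsum_mul_left, ← tsum_mul_left]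
    refine tsum_congr fun k => ?_
    have hk : 0 < n * a + β * k := by positivity
    rw [Real.rpow_sub_one hk.ne', Real.rpow_natCast, neg_add, Real.exp_add, ← Real.exp_nat_mul,
      abelCoeff, mul_neg, mul_comm (k : ℝ) β]
    field_simp
  rw [hS, eulerSeries_abel_three hβ0 hβ1 hm, Real.exp_neg]
  field_simp
end

section
/- Fix λ > 0, 0 < β < 1, x ≥ 0, and let R_n^{(β)} be the exponential-preserving Szász-Mirakyan-Jain operator. Then lim_{n→∞} n² · R_n^{(β)}(t ↦ (e^{-t} - e^{-x})⁴; x) = 3x² e^{-4x}/(1-β)⁴. -/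
open Real

open Filter

/-- The normalised Abel polynomials `A (A + β k)^(k-1) / k!`. -/
noncomputable def abelTerm (β : ℝ) : ℕ → ℝ → ℝ
  | 0, _ => 1
  | k + 1, A => A * (A + β * (k + 1)) ^ k / (Nat.factorial (k + 1) : ℝ)

lemma hasDerivAt_abelTerm_succ (β : ℝ) (k : ℕ) (A : ℝ) :
    HasDerivAt (abelTerm β (k + 1)) (abelTerm β k (A + β)) A := by
  have hid : HasDerivAt (fun y : ℝ => y + β * ((k : ℝ) + 1)) 1 A :=
    (hasDerivAt_id A).add_const _
  have h := ((hasDerivAt_id A).mul (hid.pow k)).div_const (Nat.factorial (k + 1) : ℝ)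
  have hf : abelTerm β (k + 1) =
      fun y => ((id : ℝ → ℝ) * (fun y : ℝ => y + β * ((k : ℝ) + 1)) ^ k) y /
        (Nat.factorial (k + 1) : ℝ) := by
    funext y
    simp [abelTerm]
  rw [hf]
  refine h.congr_deriv ?_
  rcases k with _ | k
  · simp [abelTerm]
  · have h1 : (Nat.factorial (k + 1) : ℝ) ≠ 0 := by positivity
    have h2 : (k : ℝ) + 1 + 1 ≠ 0 := by positivity
    simp only [abelTerm, Nat.factorial_succ (k + 1), id, Pi.pow_apply, Nat.add_sub_cancel]
    push_cast
    field_simp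
    ring

lemma abelTerm_add (β : ℝ) (n : ℕ) (A B : ℝ) :
    abelTerm β n (A + B) =
      ∑ p ∈ Finset.HasAntidiagonal.antidiagonal n, abelTerm β p.1 A * abelTerm β p.2 B := by
  induction n generalizing A B with
  | zero => simp [abelTerm]
  | succ n ih =>
    have key : ∀ y, HasDerivAt (fun y => abelTerm β (n + 1) (y + B) -
        ∑ p ∈ Finset.HasAntidiagonal.antidiagonal (n + 1),
          abelTerm β p.1 y * abelTerm β p.2 B) 0 y := by
      intro y
      simp only [Finset.Nat.antidiagonal_succ, Finset.sum_cons, Finset.sum_map,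
        Function.Embedding.prodMap, Function.Embedding.coeFn_mk, Prod.map,
        Function.Embedding.refl_apply, Nat.succ_eq_add_one]
      have h1 := (hasDerivAt_abelTerm_succ β n (y + B)).comp_add_const y B
      have h2 : HasDerivAt (fun y => ∑ p ∈ Finset.HasAntidiagonal.antidiagonal n,
          abelTerm β (p.1 + 1) y * abelTerm β p.2 B)
          (∑ p ∈ Finset.HasAntidiagonal.antidiagonal n,
            abelTerm β p.1 (y + β) * abelTerm β p.2 B) y :=
        HasDerivAt.fun_sum fun p _ => (hasDerivAt_abelTerm_succ β p.1 y).mul_const _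
      have h3 := h1.sub (h2.const_add (1 * abelTerm β (n + 1) B))
      refine h3.congr_deriv ?_
      rw [← ih, sub_eq_zero]
      congr 1
      ring
    have hc := is_const_of_deriv_eq_zero (fun y => (key y).differentiableAt)
      (fun y => (key y).deriv) A 0
    have h0 : ∑ p ∈ Finset.HasAntidiagonal.antidiagonal (n + 1),
        abelTerm β p.1 0 * abelTerm β p.2 B =
        abelTerm β (n + 1) B := by
      simp [Finset.Nat.antidiagonal_succ, abelTerm]
    rw [h0, zero_add, sub_self, sub_eq_zero] at hc
    exact hc

lemma abelTerm_nonneg {β A : ℝ} (hβ : 0 ≤ β) (hA : 0 ≤ A) (k : ℕ) : 0 ≤ abelTerm β k A := by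
  rcases k with _ | k
  · simp [abelTerm]
  · simp only [abelTerm]
    positivity

/-- The tail coefficients: `abelTerm β (k + 1) A = A * abelTail β k A`. -/
noncomputable def abelTail (β : ℝ) (k : ℕ) (A : ℝ) : ℝ :=
  (A + β * (k + 1)) ^ k / (Nat.factorial (k + 1) : ℝ)

lemma abelTerm_succ (β : ℝ) (k : ℕ) (A : ℝ) :
    abelTerm β (k + 1) A = A * abelTail β k A := by
  simp [abelTerm, abelTail, mul_div_assoc]

lemma abelTail_zero (β : ℝ) (k : ℕ) : abelTail β k 0 = abelTerm β k β := by
  rcases k with _ | k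
  · simp [abelTerm, abelTail]
  · have h2 : (k : ℝ) + 1 + 1 ≠ 0 := by positivity
    have h1 : (Nat.factorial (k + 1) : ℝ) ≠ 0 := by positivity
    simp only [abelTerm, abelTail, Nat.factorial_succ (k + 1)]
    push_cast
    have : β + β * ((k : ℝ) + 1) = β * (k + 1 + 1) := by ring
    rw [this, zero_add, pow_succ]
    field_simp

lemma abelTail_nonneg {β A : ℝ} (hβ : 0 ≤ β) (hA : 0 ≤ A) (k : ℕ) : 0 ≤ abelTail β k A := by
  unfold abelTail
  positivity

lemma abelTail_mono {β A B : ℝ} (hβ : 0 ≤ β) (hA : 0 ≤ A) (hAB : A ≤ B) (k : ℕ) :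
    abelTail β k A ≤ abelTail β k B := by
  unfold abelTail
  gcongr

lemma summable_abelTail {β w A : ℝ} (hβ : 0 < β) (hw : 0 ≤ w) (hA : 0 ≤ A)
    (hr : β * exp 1 * w < 1) : Summable fun k => abelTail β k A * w ^ (k + 1) := by
  have hg : Summable fun k : ℕ => exp (A / β) / β * (β * exp 1 * w) ^ (k + 1) :=
    ((summable_geometric_of_lt_one (by positivity) hr).mul_left
      (exp (A / β) / β * (β * exp 1 * w))).congr fun k => by ring
  refine Summable.of_nonneg_of_le
    (fun k => mul_nonneg (abelTail_nonneg hβ.le hA k) (by positivity)) (fun k => ?_) hg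
  have h1 : (A / β + (k + 1)) ^ (k + 1) / (Nat.factorial (k + 1) : ℝ) ≤ exp (A / β + (k + 1)) :=
    Real.pow_div_factorial_le_exp _ (by positivity) _
  have h2 : abelTail β k A ≤
      β ^ (k + 1) * ((A / β + (k + 1)) ^ (k + 1) / (Nat.factorial (k + 1) : ℝ)) / β := by
    have h3 : A + β * ((k : ℝ) + 1) = β * (A / β + (k + 1)) := by field_simp
    have h4 : 1 ≤ A / β + ((k : ℝ) + 1) := by
      have : 0 ≤ A / β := by positivity
      have : (0 : ℝ) ≤ k := by positivity
      linarith
    have h5 : (A / β + ((k : ℝ) + 1)) ^ k ≤ (A / β + (k + 1)) ^ (k + 1) :=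
      pow_le_pow_right₀ h4 (Nat.le_succ k)
    unfold abelTail
    rw [h3, mul_pow]
    have h6 : β ^ (k + 1) * ((A / β + (k + 1)) ^ (k + 1) / (Nat.factorial (k + 1) : ℝ)) / β =
        β ^ k * (A / β + (k + 1)) ^ (k + 1) / (Nat.factorial (k + 1) : ℝ) := by
      rw [pow_succ β]
      field_simp
    rw [h6]
    gcongr
  calc abelTail β k A * w ^ (k + 1)
      ≤ (β ^ (k + 1) * exp (A / β + (k + 1)) / β) * w ^ (k + 1) := by
        gcongr
        exact h2.trans (by gcongr)
    _ = exp (A / β) / β * (β * exp 1 * w) ^ (k + 1) := by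
        have : exp (A / β + (k + 1)) = exp (A / β) * exp 1 ^ (k + 1) := by
          rw [exp_add, ← exp_nat_mul]
          simp
        rw [this, mul_pow, mul_pow]
        ring

lemma summable_abelTerm {β w A : ℝ} (hβ : 0 < β) (hw : 0 ≤ w) (hA : 0 ≤ A)
    (hr : β * exp 1 * w < 1) : Summable fun k => abelTerm β k A * w ^ k := by
  rw [← summable_nat_add_iff 1]
  exact ((summable_abelTail hβ hw hA hr).mul_left A).congr fun k => by
    rw [abelTerm_succ, mul_assoc]

/-- Generating function of the normalised Abel polynomials. -/
noncomputable def abelGen (β w A : ℝ) : ℝ := ∑' k, abelTerm β k A * w ^ k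

lemma abelGen_add {β w A B : ℝ} (hβ : 0 < β) (hw : 0 ≤ w) (hA : 0 ≤ A) (hB : 0 ≤ B)
    (hr : β * exp 1 * w < 1) : abelGen β w (A + B) = abelGen β w A * abelGen β w B := by
  have hsA := summable_abelTerm hβ hw hA hr
  have hsB := summable_abelTerm hβ hw hB hr
  unfold abelGen
  rw [tsum_mul_tsum_eq_tsum_sum_antidiagonal_of_summable_norm hsA.norm hsB.norm]
  refine tsum_congr fun n => ?_
  rw [abelTerm_add, Finset.sum_mul]
  refine Finset.sum_congr rfl fun p hp => ?_
  rw [← Finset.HasAntidiagonal.mem_antidiagonal.mp hp, pow_add]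
  ring

lemma abelGen_eq {β w A : ℝ} (hβ : 0 < β) (hw : 0 ≤ w) (hA : 0 ≤ A)
    (hr : β * exp 1 * w < 1) :
    abelGen β w A = 1 + A * ∑' k, abelTail β k A * w ^ (k + 1) := by
  unfold abelGen
  rw [(summable_abelTerm hβ hw hA hr).tsum_eq_zero_add, ← tsum_mul_left]
  congr 1
  · simp [abelTerm]
  · exact tsum_congr fun k => by rw [abelTerm_succ, mul_assoc]

lemma abelGen_nsmul {β w A : ℝ} (hβ : 0 < β) (hw : 0 ≤ w) (hA : 0 ≤ A)
    (hr : β * exp 1 * w < 1) (m : ℕ) : abelGen β w (m * A) = abelGen β w A ^ m := by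
  induction m with
  | zero => simp [abelGen_eq hβ hw le_rfl hr]
  | succ m ih =>
    rw [pow_succ, ← ih, ← abelGen_add hβ hw (by positivity) hA hr]
    push_cast
    congr 1
    ring

lemma abelGen_eq_exp {β w A : ℝ} (hβ : 0 < β) (hw : 0 ≤ w) (hA : 0 ≤ A)
    (hr : β * exp 1 * w < 1) : abelGen β w A = exp (A * (w * abelGen β w β)) := by
  have hS : Tendsto (fun m : ℕ => ∑' k, abelTail β k (A / m) * w ^ (k + 1)) atTop
      (nhds (∑' k, abelTail β k 0 * w ^ (k + 1))) := by
    refine tendsto_tsum_of_dominated_convergence (summable_abelTail hβ hw hA hr) ?_ ?_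
    · intro k
      have hc : Continuous fun y : ℝ => abelTail β k y * w ^ (k + 1) := by
        unfold abelTail
        fun_prop
      exact (hc.tendsto 0).comp (tendsto_const_div_atTop_nhds_zero_nat A)
    · filter_upwards [eventually_ge_atTop 1] with m hm k
      have hm' : (1 : ℝ) ≤ m := by exact_mod_cast hm
      have h0 : 0 ≤ A / m := by positivity
      rw [Real.norm_of_nonneg (mul_nonneg (abelTail_nonneg hβ.le h0 k) (by positivity))]
      exact mul_le_mul_of_nonneg_right
        (abelTail_mono hβ.le h0 (div_le_self hA hm') k) (by positivity)
  have hS0 : ∑' k, abelTail β k 0 * w ^ (k + 1) = w * abelGen β w β := by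
    unfold abelGen
    rw [← tsum_mul_left]
    refine tsum_congr fun k => ?_
    rw [abelTail_zero]
    ring
  rw [hS0] at hS
  have hlim := Real.tendsto_one_add_pow_exp_of_tendsto
    (g := fun m : ℕ => A / m * ∑' k, abelTail β k (A / m) * w ^ (k + 1))
    (t := A * (w * abelGen β w β)) (by
      refine (hS.const_mul A).congr' ?_
      filter_upwards [eventually_ge_atTop 1] with m hm
      have : (m : ℝ) ≠ 0 := by positivity
      field_simp)
  refine tendsto_nhds_unique (tendsto_const_nhds.congr' ?_) hlim
  filter_upwards [eventually_ge_atTop 1] with m hm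
  have hm' : (m : ℝ) ≠ 0 := by positivity
  rw [← abelGen_eq hβ hw (by positivity) hr, ← abelGen_nsmul hβ hw (by positivity) hr,
    mul_div_cancel₀ _ hm']

lemma mul_abelGen_le_one {β w : ℝ} (hβ : 0 < β) (hw : 0 ≤ w)
    (hr : β * exp 1 * w < 1) : β * (w * abelGen β w β) ≤ 1 := by
  by_contra! hlt
  have hmono : ∀ v ∈ Set.Icc 0 w, β * exp 1 * v < 1 := fun v hv =>
    lt_of_le_of_lt (by have := hv.2; gcongr) hr
  have hcont : ContinuousOn (fun v => β * (v * abelGen β v β)) (Set.Icc 0 w) := by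
    refine continuousOn_const.mul (continuousOn_id.mul ?_)
    refine continuousOn_tsum (fun k => by fun_prop) (summable_abelTerm hβ hw hβ.le hr) ?_
    intro k v hv
    have h0 := abelTerm_nonneg hβ.le hβ.le k
    have hv0 := hv.1
    have hv1 := hv.2
    rw [Real.norm_of_nonneg (by positivity)]
    gcongr
  obtain ⟨v, hv, hv1⟩ := intermediate_value_Icc hw hcont
    (show (1 : ℝ) ∈ Set.Icc _ _ from ⟨by simp, hlt.le⟩)
  have hv2 := hmono v hv
  have h3 := abelGen_eq_exp hβ hv.1 hβ.le hv2
  simp only at hv1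
  rw [hv1] at h3
  rw [h3] at hv1
  linarith

lemma strictMonoOn_mul_exp_neg : StrictMonoOn (fun t : ℝ => t * exp (-t)) (Set.Iic 1) := by
  have hd : ∀ t : ℝ, HasDerivAt (fun t : ℝ => t * exp (-t)) ((1 - t) * exp (-t)) t := fun t =>
    ((hasDerivAt_id t).mul (hasDerivAt_neg t).exp).congr_deriv (by simp; ring)
  refine strictMonoOn_of_deriv_pos (convex_Iic 1) (by fun_prop) fun t ht => ?_
  rw [interior_Iic] at ht
  rw [(hd t).deriv]
  exact mul_pos (sub_pos.mpr ht) (exp_pos _)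

lemma hasSum_abelTerm {β z w A : ℝ} (hβ : 0 < β) (hw : 0 ≤ w) (hA : 0 ≤ A)
    (hr : β * exp 1 * w < 1) (hz : β * z ≤ 1) (hzw : z = w * exp (β * z)) :
    HasSum (fun k => abelTerm β k A * w ^ k) (exp (A * z)) := by
  have h1 : z = w * abelGen β w β := by
    have h2 := abelGen_eq_exp hβ hw hβ.le hr
    have h3 := mul_abelGen_le_one hβ hw hr
    have key : β * z = β * (w * abelGen β w β) := by
      refine strictMonoOn_mul_exp_neg.injOn hz h3 ?_
      have e1 : β * z * exp (-(β * z)) = β * w := by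
        conv_lhs => enter [1, 2]; rw [hzw]
        rw [mul_assoc, mul_assoc w, ← exp_add]
        simp
      have e2 : β * (w * abelGen β w β) * exp (-(β * (w * abelGen β w β))) = β * w := by
        conv_lhs => enter [1, 2, 2]; rw [h2]
        rw [mul_assoc, mul_assoc w, ← exp_add]
        simp
      rw [e1, e2]
    exact mul_left_cancel₀ hβ.ne' key
  rw [h1, ← abelGen_eq_exp hβ hw hA hr]
  exact (summable_abelTerm hβ hw hA hr).hasSum

lemma tendsto_sq_mul_exp_sub_one_sub {d : ℕ → ℝ} {a : ℝ}
    (hd : Tendsto (fun n : ℕ => n * d n) atTop (nhds a)) :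
    Tendsto (fun n : ℕ => (n : ℝ) ^ 2 * (exp (d n) - 1 - d n)) atTop (nhds (a ^ 2 / 2)) := by
  have hinv := tendsto_inv_atTop_nhds_zero_nat (𝕜 := ℝ)
  have hd0 : Tendsto d atTop (nhds 0) := by
    have := hinv.mul hd
    rw [zero_mul] at this
    refine this.congr' ?_
    filter_upwards [eventually_ge_atTop 1] with n hn
    have : (n : ℝ) ≠ 0 := by positivity
    field_simp
  have hrem : Tendsto (fun n : ℕ => (n : ℝ) ^ 2 * (exp (d n) - 1 - d n - d n ^ 2 / 2))
      atTop (nhds 0) := by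
    have hb : Tendsto (fun n : ℕ => |n * d n| ^ 3 * (n : ℝ)⁻¹) atTop (nhds 0) := by
      simpa using (hd.abs.pow 3).mul hinv
    refine squeeze_zero_norm' ?_ hb
    have hsmall : ∀ᶠ n in atTop, |d n| < 1 := by
      have := hd0.abs
      rw [abs_zero] at this
      exact this.eventually_lt_const one_pos
    filter_upwards [hsmall, eventually_ge_atTop 1] with n h1 hn
    have hn' : (0 : ℝ) < n := by positivity
    have hexp := Real.exp_bound h1.le (n := 3) (by norm_num)
    norm_num [Finset.sum_range_succ, Nat.factorial] at hexp
    have h3 : |exp (d n) - 1 - d n - d n ^ 2 / 2| ≤ |d n| ^ 3 := by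
      have h4 : exp (d n) - 1 - d n - d n ^ 2 / 2 = exp (d n) - (1 + d n + d n ^ 2 / 2) := by
        ring
      rw [h4]
      have : 0 ≤ |d n| ^ 3 := by positivity
      linarith
    rw [norm_mul, Real.norm_eq_abs, Real.norm_eq_abs, abs_of_nonneg (by positivity), abs_mul,
      abs_of_pos hn']
    calc (n : ℝ) ^ 2 * |exp (d n) - 1 - d n - d n ^ 2 / 2| ≤ (n : ℝ) ^ 2 * |d n| ^ 3 := by
          gcongr
      _ = (n * |d n|) ^ 3 * (n : ℝ)⁻¹ := by field_simp
  have := hrem.add ((hd.pow 2).div_const 2)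
  rw [zero_add] at this
  exact this.congr fun n => by ring

/-- Third order expansion of the inverse of `t ↦ (b - 1) t - log (1 - t)`. -/
lemma inverse_expansion {b : ℝ} (hb : 0 < b) {φ : ℝ → ℝ}
    (hφ : ∀ s, 0 < s → 0 < φ s ∧ φ s < 1 ∧ s = (b - 1) * φ s - log (1 - φ s)) :
    Tendsto (fun s => (φ s - (1 / b * s + -1 / (2 * b ^ 3) * s ^ 2 +
      (1 / (2 * b ^ 5) - 1 / (3 * b ^ 4)) * s ^ 3)) / s ^ 3) (nhdsWithin 0 (Set.Ioi 0))
      (nhds 0) := by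
  have hφ0 : Tendsto φ (nhdsWithin 0 (Set.Ioi 0)) (nhds 0) := by
    have hs : Tendsto (fun s : ℝ => s / b) (nhdsWithin 0 (Set.Ioi 0)) (nhds 0) := by
      have : Continuous fun s : ℝ => s / b := by fun_prop
      simpa using (this.tendsto 0).mono_left nhdsWithin_le_nhds
    refine squeeze_zero' ?_ ?_ hs
    · filter_upwards [self_mem_nhdsWithin] with s hs using (hφ s hs).1.le
    · filter_upwards [self_mem_nhdsWithin] with s hs
      obtain ⟨h1, h2, h3⟩ := hφ s hs
      have := Real.log_le_sub_one_of_pos (sub_pos.mpr h2)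
      rw [le_div_iff₀ hb]
      linarith
  set ε : ℝ → ℝ := fun t => (-log (1 - t) - t - t ^ 2 / 2 - t ^ 3 / 3) / t ^ 3 with hε
  have hε0 : Tendsto (fun s => ε (φ s)) (nhdsWithin 0 (Set.Ioi 0)) (nhds 0) := by
    have hb : Tendsto (fun s => φ s / (1 - φ s)) (nhdsWithin 0 (Set.Ioi 0)) (nhds 0) := by
      have := hφ0.div (hφ0.const_sub 1) (by norm_num)
      rw [zero_div] at this
      exact this
    refine squeeze_zero_norm' ?_ hb
    filter_upwards [self_mem_nhdsWithin] with s hs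
    obtain ⟨h1, h2, -⟩ := hφ s hs
    have h3 := Real.abs_log_sub_add_sum_range_le (x := φ s) (by rwa [abs_of_pos h1]) 3
    norm_num [Finset.sum_range_succ] at h3
    rw [abs_of_pos h1] at h3
    have h4 : -log (1 - φ s) - φ s - φ s ^ 2 / 2 - φ s ^ 3 / 3 =
        -(φ s + φ s ^ 2 / 2 + φ s ^ 3 / 3 + log (1 - φ s)) := by ring
    rw [hε, Real.norm_eq_abs, abs_div, h4, abs_neg, abs_of_pos (pow_pos h1 3),
      div_le_iff₀ (pow_pos h1 3)]
    exact h3.trans_eq (by ring)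
  have hpoly : Continuous fun p : ℝ × ℝ =>
      (-(1 / 3 + p.2) / b + (1 / 2 + p.1 / 3 + p.1 * p.2) / b ^ 2 +
        p.1 * (1 / 2 + p.1 / 3 + p.1 * p.2) ^ 2 / (2 * b ^ 3) -
        (1 / (2 * b ^ 5) - 1 / (3 * b ^ 4)) *
          (b + p.1 * (1 / 2 + p.1 / 3 + p.1 * p.2)) ^ 3) := by fun_prop
  have hG : Continuous fun p : ℝ × ℝ => (b + p.1 * (1 / 2 + p.1 / 3 + p.1 * p.2)) ^ 3 := by
    fun_prop
  have hpair := hφ0.prodMk_nhds hε0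
  have hlim := ((hpoly.tendsto (0, 0)).comp hpair).div ((hG.tendsto (0, 0)).comp hpair)
    (by simp [hb.ne'])
  refine (hlim.congr' ?_).trans_eq ?_
  · filter_upwards [self_mem_nhdsWithin] with s hs
    obtain ⟨h1, h2, h3⟩ := hφ s hs
    have hs' : (0 : ℝ) < s := hs
    have hlog : -log (1 - φ s) = φ s + φ s ^ 2 / 2 + φ s ^ 3 / 3 + φ s ^ 3 * ε (φ s) := by
      simp only [hε]
      field_simp
      ring
    have hsG : s = φ s * (b + φ s * (1 / 2 + φ s / 3 + φ s * ε (φ s))) := by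
      linear_combination h3 + hlog
    simp only [Function.comp, Pi.div_apply]
    generalize ε (φ s) = e at *
    generalize φ s = t at *
    set G := b + t * (1 / 2 + t / 3 + t * e) with hGdef
    have hGne : G ≠ 0 := by
      rintro h0
      rw [h0, mul_zero] at hsG
      exact hs'.ne' hsG
    rw [hsG, mul_pow t G 3, div_eq_div_iff (by positivity) (by positivity)]
    have : -(1 / 3 + e) / b + (1 / 2 + t / 3 + t * e) / b ^ 2 +
        t * (1 / 2 + t / 3 + t * e) ^ 2 / (2 * b ^ 3) =
        (t - (1 / b * (t * G) + -1 / (2 * b ^ 3) * (t * G) ^ 2)) / t ^ 3 := by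
      rw [hGdef]
      field_simp
      ring
    rw [this]
    field_simp
    ring
  · congr 1
    field_simp
    ring

lemma tendsto_fourth_difference {φ : ℝ → ℝ} {c₀ c₁ c₂ lam : ℝ} (x : ℝ) (hc₀ : 0 < c₀)
    (hlam : 0 < lam) (hφ : ∀ s, 0 < s → 0 < φ s)
    (h : Tendsto (fun s => (φ s - (c₀ * s + c₁ * s ^ 2 + c₂ * s ^ 3)) / s ^ 3)
      (nhdsWithin 0 (Set.Ioi 0)) (nhds 0)) :
    Tendsto (fun n : ℕ => (n : ℝ) ^ 2 *
      (1 - 4 * exp (1 * x - lam * x * φ (1 / n) / φ (lam / n))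
        + 6 * exp (2 * x - lam * x * φ (2 / n) / φ (lam / n))
        - 4 * exp (3 * x - lam * x * φ (3 / n) / φ (lam / n))
        + exp (4 * x - lam * x * φ (4 / n) / φ (lam / n)))) atTop
      (nhds (12 * (x * c₁ / c₀) ^ 2)) := by
  have hinv := tendsto_inv_atTop_nhds_zero_nat (𝕜 := ℝ)
  have hr : ∀ μ : ℝ, 0 < μ → Tendsto (fun n : ℕ => (n : ℝ) ^ 3 *
      (φ (μ / n) - (c₀ * (μ / n) + c₁ * (μ / n) ^ 2 + c₂ * (μ / n) ^ 3))) atTop (nhds 0) := by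
    intro μ hμ
    have hw : Tendsto (fun n : ℕ => μ / n) atTop (nhdsWithin 0 (Set.Ioi 0)) := by
      refine tendsto_nhdsWithin_iff.mpr ⟨tendsto_const_div_atTop_nhds_zero_nat μ, ?_⟩
      filter_upwards [eventually_ge_atTop 1] with n hn
      have : (0 : ℝ) < n := by positivity
      exact div_pos hμ this
    have := (h.comp hw).mul_const (μ ^ 3)
    rw [zero_mul] at this
    refine this.congr' ?_
    filter_upwards [eventually_ge_atTop 1] with n hn
    have hn' : (n : ℝ) ≠ 0 := by positivity
    simp only [Function.comp]
    generalize φ (μ / n) = t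
    field_simp
  have hU : ∀ μ : ℝ, 0 < μ → Tendsto (fun n : ℕ => (n : ℝ) ^ 2 * (φ (μ / n) - c₀ * (μ / n)))
      atTop (nhds (c₁ * μ ^ 2)) := by
    intro μ hμ
    have h1 := (((hr μ hμ).add_const (c₂ * μ ^ 3)).mul hinv).const_add (c₁ * μ ^ 2)
    rw [mul_zero, add_zero] at h1
    refine h1.congr' ?_
    filter_upwards [eventually_ge_atTop 1] with n hn
    have hn' : (n : ℝ) ≠ 0 := by positivity
    generalize φ (μ / n) = t
    field_simp
    ring
  have hV : Tendsto (fun n : ℕ => (n : ℝ) * φ (lam / n)) atTop (nhds (c₀ * lam)) := by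
    have h1 := ((hU lam hlam).mul hinv).const_add (c₀ * lam)
    rw [mul_zero, add_zero] at h1
    refine h1.congr' ?_
    filter_upwards [eventually_ge_atTop 1] with n hn
    have hn' : (n : ℝ) ≠ 0 := by positivity
    generalize φ (lam / n) = t
    field_simp
    ring
  have hne : c₀ * lam ≠ 0 := by positivity
  have hd : ∀ μ : ℝ, 0 < μ → Tendsto
      (fun n : ℕ => n * (μ * x - lam * x * φ (μ / n) / φ (lam / n))) atTop
      (nhds (x * c₁ / c₀ * (μ * (lam - μ)))) := by
    intro μ hμ
    have h1 := ((((hU lam hlam).const_mul μ).sub ((hU μ hμ).const_mul lam)).const_mul x).div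
      hV hne
    refine (h1.congr' ?_).trans_eq ?_
    · filter_upwards [eventually_ge_atTop 1] with n hn
      have hn' : (0 : ℝ) < n := by positivity
      have hp := (hφ (lam / n) (by positivity)).ne'
      simp only [Pi.div_apply]
      generalize φ (lam / n) = t at *
      generalize φ (μ / n) = u
      field_simp
      ring
    · congr 1
      field_simp
  have hlin : Tendsto (fun n : ℕ => (n : ℝ) ^ 2 *
      (-4 * (1 * x - lam * x * φ (1 / n) / φ (lam / n))
        + 6 * (2 * x - lam * x * φ (2 / n) / φ (lam / n))
        - 4 * (3 * x - lam * x * φ (3 / n) / φ (lam / n))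
        + (4 * x - lam * x * φ (4 / n) / φ (lam / n)))) atTop (nhds 0) := by
    have h1 := (((((hr 1 (by norm_num)).const_mul (-4)).add
      ((hr 2 (by norm_num)).const_mul 6)).sub ((hr 3 (by norm_num)).const_mul 4)).add
      (hr 4 (by norm_num))).const_mul (-(lam * x))
    have h2 := h1.div hV hne
    refine (h2.congr' ?_).trans_eq (by simp)
    filter_upwards [eventually_ge_atTop 1] with n hn
    have hn' : (0 : ℝ) < n := by positivity
    have hp := (hφ (lam / n) (by positivity)).ne'
    simp only [Pi.div_apply]
    generalize φ (lam / n) = t at *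
    generalize φ (1 / n) = u₁
    generalize φ (2 / n) = u₂
    generalize φ (3 / n) = u₃
    generalize φ (4 / n) = u₄
    field_simp
    ring
  have he := fun μ hμ => tendsto_sq_mul_exp_sub_one_sub (hd μ hμ)
  have := (((((he 1 (by norm_num)).const_mul (-4)).add
    ((he 2 (by norm_num)).const_mul 6)).sub ((he 3 (by norm_num)).const_mul 4)).add
    (he 4 (by norm_num))).add hlin
  refine (this.congr fun n => ?_).trans_eq ?_
  · ring
  · congr 1
    ring

lemma SMJ_term_eq {β A : ℝ} (hA : 0 < A) (k : ℕ) :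
    A * ((A + β * k) ^ ((k : ℝ) - 1) / (Nat.factorial k : ℝ) * exp (-(A + β * k))) =
      exp (-A) * (abelTerm β k A * exp (-β) ^ k) := by
  have hexp : exp (-(A + β * k)) = exp (-A) * exp (-β) ^ k := by
    rw [← exp_nat_mul, ← exp_add]
    congr 1
    ring
  rw [hexp]
  rcases k with _ | k
  · simp [abelTerm, Real.rpow_neg_one, hA.ne']
  · have : ((k + 1 : ℕ) : ℝ) - 1 = k := by simp
    rw [this, Real.rpow_natCast]
    simp only [abelTerm]
    push_cast
    ring

/-- The defining properties of `z = -W(-β exp (-β - s)) / β`. -/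
lemma lambert_branch {W : ℝ → ℝ}
    (hW : ∀ y, -exp (-1) ≤ y → W y * exp (W y) = y ∧ -1 ≤ W y) {β s : ℝ}
    (hβ0 : 0 < β) (hβ1 : β < 1) (hs : 0 ≤ s) {z : ℝ}
    (hz : z = -(1 / β) * W (-β * exp (-β - s))) :
    β * z ≤ 1 ∧ z = exp (-β - s) * exp (β * z) := by
  have hy : -exp (-1) ≤ -β * exp (-β - s) := by
    have h1 := strictMonoOn_mul_exp_neg (Set.mem_Iic.mpr hβ1.le) (Set.mem_Iic.mpr le_rfl) hβ1
    have h2 : β * exp (-β - s) ≤ β * exp (-β) := by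
      gcongr
      linarith
    simp only [one_mul] at h1
    linarith
  obtain ⟨h1, h2⟩ := hW _ hy
  have hWz : W (-β * exp (-β - s)) = -(β * z) := by
    rw [hz]
    field_simp
  rw [hWz] at h1 h2
  refine ⟨by linarith, ?_⟩
  have h3 : z * exp (-(β * z)) = exp (-β - s) := by
    have : β * (z * exp (-(β * z))) = β * exp (-β - s) := by linarith
    exact mul_left_cancel₀ hβ0.ne' this
  rw [← h3, mul_assoc, ← exp_add]
  simp

lemma branch_unit {β s z : ℝ} (hβ0 : 0 < β) (hβ1 : β < 1) (hs : 0 < s) (hz : β * z ≤ 1)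
    (hzw : z = exp (-β - s) * exp (β * z)) :
    0 < 1 - z ∧ 1 - z < 1 ∧ s = (1 - β - 1) * (1 - z) - log (1 - (1 - z)) := by
  have hz0 : 0 < z := by
    rw [hzw]
    positivity
  have hlog : log z = -β - s + β * z := by
    conv_lhs => rw [hzw]
    rw [← exp_add, log_exp]
  have hlt : β * z < β := by
    refine (strictMonoOn_mul_exp_neg.lt_iff_lt hz hβ1.le).mp ?_
    have h1 : β * z * exp (-(β * z)) = β * exp (-β - s) := by
      conv_lhs => enter [1, 2]; rw [hzw]
      rw [mul_assoc, mul_assoc (exp (-β - s)), ← exp_add]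
      simp
    simp only [h1]
    gcongr
    linarith
  have hz1 : z < 1 := by nlinarith
  refine ⟨by linarith, by linarith, ?_⟩
  rw [sub_sub_cancel, hlog]
  ring

lemma hasSum_SMJ_exp {β s z A : ℝ} (hβ0 : 0 < β) (hβ1 : β < 1) (hs : 0 ≤ s) (hA : 0 < A)
    (hz : β * z ≤ 1) (hzw : z = exp (-β - s) * exp (β * z)) :
    HasSum (fun k : ℕ => A * ((A + β * k) ^ ((k : ℝ) - 1) / (Nat.factorial k : ℝ) *
      exp (-(A + β * k))) * exp (-s) ^ k) (exp (-(A * (1 - z)))) := by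
  have hr : β * exp 1 * exp (-β - s) < 1 := by
    have h1 : β < exp (β - 1) := by
      have := Real.add_one_lt_exp (x := β - 1) (by linarith)
      linarith
    calc β * exp 1 * exp (-β - s) < exp (β - 1) * exp 1 * exp (-β - s) := by gcongr
      _ = exp (-s) := by
        rw [← exp_add, ← exp_add]
        congr 1
        ring
      _ ≤ 1 := exp_le_one_iff.mpr (by linarith)
  have h2 := (hasSum_abelTerm hβ0 (exp_pos _).le hA.le hr hz hzw).mul_left (exp (-A))
  rw [← exp_add] at h2
  have h3 : exp (-(A * (1 - z))) = exp (-A + A * z) := by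
    congr 1
    ring
  rw [h3]
  refine h2.congr_fun fun k => ?_
  rw [SMJ_term_eq hA, sub_eq_add_neg, exp_add, mul_pow]
  ring

/-- `lim_{n→∞} n² · R_n^{(β)}(t ↦ (e^{-t} - e^{-x})⁴; x) = 3x² e^{-4x}/(1-β)⁴`. -/
theorem SMJ_fourth_exp_central_moment_limit (W : ℝ → ℝ)
    (hW : ∀ y, -Real.exp (-1) ≤ y → W y * Real.exp (W y) = y ∧ -1 ≤ W y)
    (β lam x : ℝ) (hβ0 : 0 < β) (hβ1 : β < 1) (hlam : 0 < lam) (hx : 0 ≤ x) :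
    Tendsto
      (fun n : ℕ => (n : ℝ) ^ 2 *
        SMJ β n
          (-lam * x / (n * (-(1 / β) * W (-β * Real.exp (-β - lam / n)) - 1)))
          (fun t => (Real.exp (-t) - Real.exp (-x)) ^ 4))
      atTop (nhds (3 * x ^ 2 * Real.exp (-4 * x) / (1 - β) ^ 4)) := by
  set z : ℝ → ℝ := fun s => -(1 / β) * W (-β * exp (-β - s))
  have hbr : ∀ s, 0 ≤ s → β * z s ≤ 1 ∧ z s = exp (-β - s) * exp (β * z s) := fun s hs =>
    lambert_branch hW hβ0 hβ1 hs rfl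
  have hφ : ∀ s, 0 < s → 0 < 1 - z s ∧ 1 - z s < 1 ∧
      s = (1 - β - 1) * (1 - z s) - log (1 - (1 - z s)) := fun s hs =>
    branch_unit hβ0 hβ1 hs (hbr s hs.le).1 (hbr s hs.le).2
  have hb : 0 < 1 - β := sub_pos.mpr hβ1
  have hlim := (tendsto_fourth_difference (φ := fun s => 1 - z s) x (by positivity) hlam
    (fun s hs => (hφ s hs).1) (inverse_expansion hb hφ)).const_mul (exp (-4 * x))
  refine (hlim.congr' ?_).trans_eq ?_
  · filter_upwards [eventually_ge_atTop 1] with n hn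
    have hn' : (0 : ℝ) < n := by positivity
    have hpos := (hφ (lam / n) (by positivity)).1
    change _ = (n : ℝ) ^ 2 * SMJ β n (-lam * x / (n * (z (lam / n) - 1))) _
    have hnA : n * (-lam * x / (n * (z (lam / n) - 1))) = lam * x / (1 - z (lam / n)) := by
      have : z (lam / n) - 1 ≠ 0 := by linarith
      field_simp
      ring
    rcases hx.eq_or_lt with rfl | hx
    · simp [SMJ]
      norm_num
    unfold SMJ
    rw [hnA]
    set A := lam * x / (1 - z (lam / n)) with hA
    have hApos : 0 < A := by positivity
    have hsum : ∀ j : ℝ, 0 ≤ j → HasSum (fun k : ℕ => A * ((A + β * k) ^ ((k : ℝ) - 1) /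
        (Nat.factorial k : ℝ) * exp (-(A + β * k))) * exp (-(j / n)) ^ k)
        (exp (-(A * (1 - z (j / n))))) := fun j hj =>
      have hjn : 0 ≤ j / (n : ℝ) := by positivity
      hasSum_SMJ_exp hβ0 hβ1 hjn hApos (hbr _ hjn).1 (hbr _ hjn).2
    have hsum0 := hasSum_SMJ_exp (z := 1) hβ0 hβ1 le_rfl hApos (by linarith)
      (by rw [← exp_add]; simp)
    have hterm : ∀ (μ : ℝ) (k : ℕ), exp (-(μ / n)) ^ k = exp (-(k / n)) ^ μ := fun μ k => by
      rw [← exp_nat_mul, ← exp_mul]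
      congr 1
      ring
    have hT := (((((hsum 4 (by norm_num)).sub
      ((hsum 3 (by norm_num)).mul_left (4 * exp (-x)))).add
      ((hsum 2 (by norm_num)).mul_left (6 * exp (-x) ^ 2))).sub
      ((hsum 1 (by norm_num)).mul_left (4 * exp (-x) ^ 3))).add
      (hsum0.mul_left (exp (-x) ^ 4)))
    have hS : A * ∑' k : ℕ, (A + β * k) ^ ((k : ℝ) - 1) / (Nat.factorial k : ℝ) *
        exp (-(A + β * k)) * (exp (-(k / n)) - exp (-x)) ^ 4 = _ :=
      tsum_mul_left.symm.trans ((tsum_congr fun k => by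
        rw [hterm 4 k, hterm 3 k, hterm 2 k, hterm 1 k]
        simp only [neg_zero, exp_zero, one_pow, Real.rpow_one, Real.rpow_ofNat]
        ring).trans hT.tsum_eq)
    have hexp : ∀ (j : ℝ) (y : ℝ), exp (j * x - lam * x * y / (1 - z (lam / n))) =
        exp x ^ j * exp (-(A * y)) := fun j y => by
      rw [← exp_mul, ← exp_add]
      congr 1
      rw [hA]
      ring
    have hX : exp (-x) * exp x = 1 := by rw [← exp_add]; simp
    have h4 : exp (-4 * x) = exp (-x) ^ 4 := by
      rw [← exp_nat_mul]
      congr 1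
      push_cast
      ring
    rw [hS]
    simp only [hexp, h4, Real.rpow_one, Real.rpow_ofNat, sub_self, mul_zero, neg_zero, exp_zero]
    generalize exp (-x) = X at *
    generalize exp x = Y at *
    obtain rfl : Y = X⁻¹ := eq_inv_of_mul_eq_one_right hX
    have hX0 : X ≠ 0 := left_ne_zero_of_mul_eq_one hX
    field_simp
    ring
  · congr 1
    field_simp
    ring
end

section
/- Let 0 ≤ β < 1, n ≥ 1, a > 0, μ ≥ 0, x ≥ 0, and let z_μ ∈ (0,1] solve z e^{-βz} = e^{-β-μ/n}. Then the Szász-Mirakyan-Jain operator with parameter a satisfies R(t ↦ e^{-μt}(t - x)) — i.e. the exponentially weighted first central moment — equals (a z_μ/(1 - β z_μ) - x) · e^{na(z_μ - 1)}. -/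
open Real

open Finset in
/-- The `m`-th finite difference of `k ↦ (d + β * k) ^ m`. -/
theorem sum_neg_one_pow_choose_mul_affine_pow (d β : ℝ) (m : ℕ) :
    ∑ k ∈ range (m + 1), (-1 : ℝ) ^ (m - k) * m.choose k * (d + β * k) ^ m =
      m.factorial * β ^ m := by
  rcases eq_or_ne β 0 with rfl | hβ
  · rcases eq_or_ne m 0 with rfl | hm
    · simp
    · have h := add_pow (1 : ℝ) (-1) m
      simp only [add_neg_cancel, zero_pow hm, one_pow, one_mul] at h
      simp only [zero_mul, add_zero, zero_pow hm, mul_zero]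
      rw [← sum_mul, ← h, zero_mul]
  · have h := congrFun (fwdDiff_iter_eq_factorial (R := ℝ) (n := m)) (d / β)
    rw [fwdDiff_iter_eq_sum_shift] at h
    have h' : ((m.factorial : ℝ → ℝ) (d / β)) = (m.factorial : ℝ) := by simp
    rw [h'] at h
    rw [← h, sum_mul]
    refine sum_congr rfl fun k _ => ?_
    have : d + β * k = β * (d / β + k • (1 : ℝ)) := by
      field_simp
      simp
    rw [this, mul_pow, zsmul_eq_mul]
    push_cast
    ring

open Finset in
theorem sum_antidiagonal_affine_pow_mul_exp_coeff (d β z : ℝ) (m : ℕ) :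
    ∑ p ∈ antidiagonal m, (d + β * p.1) ^ p.1 / (p.1.factorial : ℝ) * z ^ p.1 *
      ((-(d + β * p.1) * z) ^ p.2 / (p.2.factorial : ℝ)) = (β * z) ^ m := by
  rw [Nat.sum_antidiagonal_eq_sum_range_succ_mk]
  have h := sum_neg_one_pow_choose_mul_affine_pow d β m
  have hm : (m.factorial : ℝ) ≠ 0 := by positivity
  rw [mul_pow, eq_div_of_mul_eq hm ((mul_comm _ _).trans h.symm), sum_div, sum_mul]
  refine sum_congr rfl fun k hk => ?_
  have hk' : k ≤ m := Nat.lt_succ_iff.mp (mem_range.mp hk)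
  obtain ⟨j, rfl⟩ := Nat.exists_eq_add_of_le hk'
  simp only [Nat.add_sub_cancel_left]
  rw [Nat.cast_choose ℝ hk', Nat.add_sub_cancel_left, neg_mul, neg_pow, mul_pow]
  have h1 : (k.factorial : ℝ) ≠ 0 := by positivity
  have h2 : (j.factorial : ℝ) ≠ 0 := by positivity
  field_simp
  ring

open Finset in
/-- The generating function of `(d + β * k) ^ k / k!` at `z * exp (-β * z)`, for `z` so small that
expanding the exponential gives an absolutely convergent double series. -/
theorem hasSum_affine_pow_of_summable {d β z : ℝ} (hd : 0 ≤ d) (hβ : 0 ≤ β) (hz : 0 ≤ z)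
    (hβz : β * z < 1)
    (hs : Summable fun k : ℕ =>
      (d + β * k) ^ k / (k.factorial : ℝ) * (z * exp (β * z)) ^ k) :
    HasSum (fun k : ℕ => (d + β * k) ^ k / (k.factorial : ℝ) * (z * exp (-β * z)) ^ k)
      (exp (d * z) / (1 - β * z)) := by
  have hexp (y : ℝ) : HasSum (fun j : ℕ => y ^ j / (j.factorial : ℝ)) (exp y) := by
    rw [Real.exp_eq_exp_ℝ]
    exact NormedSpace.exp_series_hasSum_exp' (𝕂 := ℝ) y |>.congr_fun fun j => by
      simp [div_eq_inv_mul]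
  let F : ℕ × ℕ → ℝ := fun p => (d + β * p.1) ^ p.1 / (p.1.factorial : ℝ) * z ^ p.1 *
    ((-(d + β * p.1) * z) ^ p.2 / (p.2.factorial : ℝ))
  have hF : Summable F := by
    apply Summable.of_norm
    have hn (p : ℕ × ℕ) : ‖F p‖ = (d + β * p.1) ^ p.1 / (p.1.factorial : ℝ) * z ^ p.1 *
        (((d + β * p.1) * z) ^ p.2 / (p.2.factorial : ℝ)) := by
      have hy : 0 ≤ d + β * p.1 := by positivity
      simp only [F, norm_mul, norm_div, norm_pow, norm_neg, Real.norm_eq_abs, abs_of_nonneg hy,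
        abs_of_nonneg hz, Nat.abs_cast]
    rw [summable_prod_of_nonneg fun p => norm_nonneg _]
    simp only [hn]
    refine ⟨fun k => ((hexp _).mul_left _).summable, ?_⟩
    refine (hs.mul_left (exp (d * z))).congr fun k => ?_
    rw [((hexp _).mul_left _).tsum_eq, mul_pow, ← exp_nat_mul,
      show (d + β * k) * z = d * z + k * (β * z) by ring, exp_add]
    ring
  have hdiag : HasSum F (1 - β * z)⁻¹ := by
    have hs := ((HasAntidiagonal.sigmaAntidiagonalEquivProd (A := ℕ)).hasSum_iff.2
      hF.hasSum).sigma fun m => hasSum_fintype _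
    have hg := hasSum_geometric_of_lt_one (mul_nonneg hβ hz) hβz
    rw [← hs.unique (hg.congr_fun fun m => ?_)]
    · exact hF.hasSum
    · rw [← sum_antidiagonal_affine_pow_mul_exp_coeff d β z m]
      exact sum_finset_coe F (antidiagonal m)
  have hrow := hdiag.prod_fiberwise fun k => (hexp (-(d + β * k) * z)).mul_left
    ((d + β * k) ^ k / (k.factorial : ℝ) * z ^ k)
  have := hrow.mul_left (exp (d * z))
  rw [← div_eq_mul_inv] at this
  refine this.congr_fun fun k => ?_
  rw [mul_pow, ← exp_nat_mul,
      show -(d + β * k) * z = - (d * z) + k * (-β * z) by ring, exp_add, exp_neg]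
  field_simp

theorem le_radius_ofScalars_affine_pow {d β z : ℝ} (hd : 0 ≤ d) (hβ : 0 ≤ β) (hz : 0 ≤ z) :
    ENNReal.ofReal (z * exp (-β * z)) ≤
      (FormalMultilinearSeries.ofScalars ℝ
        fun k : ℕ => (d + β * k) ^ k / (k.factorial : ℝ)).radius := by
  refine FormalMultilinearSeries.le_radius_of_bound _ (exp (d * z)) fun k => ?_
  have hy : 0 ≤ d + β * k := by positivity
  rw [FormalMultilinearSeries.ofScalars_norm, Real.coe_toNNReal _ (by positivity),
    Real.norm_of_nonneg (by positivity), mul_pow, ← exp_nat_mul]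
  have h := Real.pow_div_factorial_le_exp ((d + β * k) * z) (by positivity) k
  calc (d + β * k) ^ k / (k.factorial : ℝ) * (z ^ k * exp (k * (-β * z)))
      = ((d + β * k) * z) ^ k / (k.factorial : ℝ) * exp (k * (-β * z)) := by
        rw [mul_pow]
        ring
    _ ≤ exp ((d + β * k) * z) * exp (k * (-β * z)) := by gcongr
    _ = exp (d * z) := by rw [← exp_add]; ring_nf

theorem exists_gt_mul_exp_neg_lt {β z : ℝ} (hβ : 0 ≤ β) (hz : 0 ≤ z) (hβz : β * z < 1) :
    ∃ y, 0 ≤ y ∧ z * exp (-β * z) < y * exp (-β * y) := by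
  obtain ⟨y, hzy, hβy⟩ : ∃ y, z < y ∧ β * y < 1 := by
    refine ⟨z + (1 - β * z) / (1 + β), ?_, ?_⟩
    · have : 0 < (1 - β * z) / (1 + β) := div_pos (by linarith) (by linarith)
      linarith
    · have h : β * (z + (1 - β * z) / (1 + β)) = (β * z + β) / (1 + β) := by
        field_simp
        ring
      rw [h, div_lt_one (by linarith)]
      linarith
  refine ⟨y, hz.trans hzy.le, ?_⟩
  have hexp : 1 - β * (y - z) ≤ exp (-β * (y - z)) := by
    have := add_one_le_exp (-β * (y - z))
    linarith
  have h : z < y * exp (-β * (y - z)) := by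
    refine lt_of_lt_of_le ?_ (mul_le_mul_of_nonneg_left hexp (hz.trans hzy.le))
    nlinarith [mul_pos (sub_pos.2 hzy) (sub_pos.2 hβy)]
  calc z * exp (-β * z) < y * exp (-β * (y - z)) * exp (-β * z) := by gcongr
    _ = y * exp (-β * y) := by rw [mul_assoc, ← exp_add]; ring_nf

open Filter Topology FormalMultilinearSeries in
/-- The generating function of `(d + β * k) ^ k / k!`, evaluated at `z * exp (-β * z)`. -/
theorem hasSum_affine_pow {d β z : ℝ} (hd : 0 ≤ d) (hβ : 0 ≤ β) (hz : 0 < z)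
    (hβz : β * z < 1) :
    HasSum (fun k : ℕ => (d + β * k) ^ k / (k.factorial : ℝ) * (z * exp (-β * z)) ^ k)
      (exp (d * z) / (1 - β * z)) := by
  set p := ofScalars ℝ fun k : ℕ => (d + β * k) ^ k / (k.factorial : ℝ) with hp
  have hpos : 0 < p.radius :=
    lt_of_lt_of_le (ENNReal.ofReal_pos.2 (by positivity))
      (le_radius_ofScalars_affine_pow hd hβ hz.le)
  have hmem {y : ℝ} (hy : 0 ≤ y) (hβy : β * y < 1) :
      y * exp (-β * y) ∈ Metric.eball (0 : ℝ) p.radius := by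
    obtain ⟨u, hu, hlt⟩ := exists_gt_mul_exp_neg_lt hβ hy hβy
    refine lt_of_lt_of_le ?_ (le_radius_ofScalars_affine_pow hd hβ hu)
    rw [edist_zero_right, Real.enorm_of_nonneg (by positivity)]
    exact (ENNReal.ofReal_lt_ofReal_iff_of_nonneg (by positivity)).2 hlt
  have hsum {w : ℝ} (hw : w ∈ Metric.eball (0 : ℝ) p.radius) :
      HasSum (fun k : ℕ => (d + β * k) ^ k / (k.factorial : ℝ) * w ^ k) (p.sum w) := by
    exact (p.hasSum hw).congr_fun fun k => by simp [hp, mul_comm]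
  let U : Set ℝ := {y | 0 < y ∧ β * y < 1}
  have hU : IsOpen U :=
    (isOpen_lt continuous_const continuous_id).inter
      (isOpen_lt (continuous_const.mul continuous_id) continuous_const)
  have hUconv : Convex ℝ U :=
    (convex_Ioi 0).inter (convex_halfSpace_lt (IsLinearMap.isLinearMap_smul β) 1)
  have hlhs : AnalyticOnNhd ℝ (fun y => p.sum (y * exp (-β * y))) U := fun y hy =>
    AnalyticAt.fun_comp (g := p.sum)
      ((p.hasFPowerSeriesOnBall hpos).analyticAt_of_mem (hmem hy.1.le hy.2)) (by fun_prop)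
  have hrhs : AnalyticOnNhd ℝ (fun y => exp (d * y) / (1 - β * y)) U := fun y hy =>
    AnalyticAt.div (by fun_prop) (by fun_prop) (by linarith [hy.2])
  let V : Set ℝ := {y | y * exp (β * y) ∈ Metric.eball (0 : ℝ) p.radius}
  have hV : IsOpen V := Metric.isOpen_eball.preimage (by fun_prop)
  have hVU : (V ∩ U).Nonempty := by
    have h0 : ∀ᶠ y in 𝓝 (0 : ℝ), y ∈ V := hV.mem_nhds (by simpa [V] using hpos)
    have h1 : ∀ᶠ y in 𝓝 (0 : ℝ), β * y < 1 :=
      (isOpen_lt (by fun_prop) continuous_const).mem_nhds (by simp)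
    obtain ⟨y, hy⟩ := (((h0.and h1).filter_mono nhdsWithin_le_nhds).and
      (eventually_mem_nhdsWithin (s := Set.Ioi 0))).exists
    exact ⟨y, hy.1.1, hy.2, hy.1.2⟩
  obtain ⟨y₀, hy₀⟩ := hVU
  have heq : (fun y => p.sum (y * exp (-β * y))) =ᶠ[𝓝 y₀]
      fun y => exp (d * y) / (1 - β * y) := by
    filter_upwards [(hV.inter hU).mem_nhds hy₀] with y hy
    exact (hsum (hmem hy.2.1.le hy.2.2)).unique
      (hasSum_affine_pow_of_summable hd hβ hy.2.1.le hy.2.2 (hsum hy.1).summable)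
  have := hlhs.eqOn_of_preconnected_of_eventuallyEq hrhs hUconv.isPreconnected hy₀.2 heq ⟨hz, hβz⟩
  beta_reduce at this
  rw [← this]
  exact hsum (hmem hz.le hβz)

/-- Exponentially weighted first central moment: if `z_μ ∈ (0,1]` solves
`z e^{-βz} = e^{-β-μ/n}`, then
`R(t ↦ e^{-μt}(t-x)) = (a z_μ/(1-β z_μ) - x) e^{na(z_μ-1)}`. -/
theorem SMJ_exp_weighted_first_central_moment (β a μ x zμ : ℝ) (n : ℕ)
    (hβ0 : 0 ≤ β) (hβ1 : β < 1) (hn : 1 ≤ n) (ha : 0 < a) (hμ : 0 ≤ μ) (hx : 0 ≤ x)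
    (hz0 : 0 < zμ) (hz1 : zμ ≤ 1)
    (hz : zμ * Real.exp (-β * zμ) = Real.exp (-β - μ / n)) :
    SMJ β n a (fun t => Real.exp (-μ * t) * (t - x)) =
      (a * zμ / (1 - β * zμ) - x) * Real.exp (n * a * (zμ - 1)) := by
  have hn' : (0 : ℝ) < n := by exact_mod_cast hn
  have hβz : β * zμ < 1 := by nlinarith
  have hne : 1 - β * zμ ≠ 0 := by linarith
  obtain ⟨c, hc⟩ : ∃ c, c = n * a := ⟨_, rfl⟩
  have hc0 : 0 < c := hc ▸ by positivity
  have hS := hasSum_affine_pow hc0.le hβ0 hz0 hβz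
  set w := zμ * exp (-β * zμ) with hw
  have hU : HasSum (fun k : ℕ => k * ((c + β * k) ^ k / (c + β * k) / (k.factorial : ℝ) * w ^ k))
      (zμ * exp (c * zμ) / (1 - β * zμ)) := by
    rw [← hasSum_nat_add_iff' 1]
    have h := (hasSum_affine_pow (add_nonneg hc0.le hβ0) hβ0 hz0 hβz).mul_left w
    rw [Finset.sum_range_one, Nat.cast_zero, zero_mul, sub_zero,
      show zμ * exp (c * zμ) / (1 - β * zμ) = w * (exp ((c + β) * zμ) / (1 - β * zμ)) by
        rw [hw, show (c + β) * zμ = c * zμ + β * zμ by ring, exp_add, neg_mul, exp_neg]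
        field_simp]
    refine h.congr_fun fun k => ?_
    have hy : c + β + β * k ≠ 0 := by positivity
    push_cast [Nat.factorial_succ]
    rw [show c + β * (k + 1) = c + β + β * k by ring, pow_succ, pow_succ, ← hw]
    field_simp
  have hT : HasSum (fun k : ℕ => c * ((c + β * k) ^ k / (c + β * k) / (k.factorial : ℝ) * w ^ k))
      (exp (c * zμ)) := by
    have h := hS.sub (hU.mul_left β)
    rw [show exp (c * zμ) / (1 - β * zμ) - β * (zμ * exp (c * zμ) / (1 - β * zμ)) =
      exp (c * zμ) by
        rw [mul_div_assoc', ← sub_div, div_eq_iff hne]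
        ring] at h
    refine h.congr_fun fun k => ?_
    have hy : c + β * k ≠ 0 := by positivity
    field_simp
    ring
  have hmain := ((hU.mul_left (c / n)).sub (hT.mul_left x)).mul_left (exp (-c))
  unfold SMJ
  rw [← tsum_mul_left, ← hc]
  convert hmain.tsum_eq using 1
  · congr 1
    funext k
    have hy : 0 < c + β * k := by positivity
    have hexp : exp (-(c + β * k)) * exp (-μ * (k / n)) = exp (-c) * w ^ k := by
      rw [hz, ← exp_nat_mul, ← exp_add, ← exp_add]
      ring_nf
    rw [rpow_sub_one hy.ne', rpow_natCast]
    linear_combination (c * ((c + β * k) ^ k / (c + β * k) / (k.factorial : ℝ)) * (k / n - x)) * hexp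
  · rw [mul_sub, mul_one, sub_eq_neg_add (c * zμ), exp_add, hc]
    field_simp
end
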